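/- Let X be a Banach space with an S_ω-unconditional basis (x_i). Assume (x_i) is S_ω-equivalent to the unit vector basis of a regular p-convexified mixed Tsirelson space T^{(p)}[(S_n, θ_n)_{n∈ℕ}], 1 ≤ p < ∞, and that θ_n/θ^n → 0, where θ = lim_n θ_n^{1/n}. Then X admits a bounded, strictly singular, non-compact operator defined on an infinite-dimensional closed subspace of X. -/

import Mathlib

open Finset Filter


/-- The minimum of a finite set of naturals (0 for the empty set). -/
noncomputable def fmin (s : Finset ℕ) : ℕ := sInf (s : Set ℕ)

/-- The Schreier families `S_n`, `n ∈ ℕ`. -/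
def SchreierNat : ℕ → Set (Finset ℕ)
  | 0 => {F | F.card ≤ 1}
  | n + 1 => {F | ∃ (k : ℕ) (E : Fin k → Finset ℕ),
      (∀ i, E i ∈ SchreierNat n) ∧
      (∀ i j : Fin k, i < j → ∀ a ∈ E i, ∀ b ∈ E j, a < b) ∧
      (∀ i, ∀ a ∈ E i, k ≤ a) ∧
      F = Finset.univ.biUnion E}

/-- The Schreier family `S_ω`, defined using the sequence `n ↗ ω`. -/
def SchreierOmega : Set (Finset ℕ) :=
  {F | ∃ n : ℕ, F ∈ SchreierNat n ∧ ∀ a ∈ F, n ≤ a}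

/-- A finite sequence `E 0 < E 1 < … < E (k-1)` of nonempty finite subsets of `ℕ` is
`𝒮`-admissible if the set of minima belongs to `𝒮`. -/
def SAdmissible (𝒮 : Set (Finset ℕ)) {k : ℕ} (E : Fin k → Finset ℕ) : Prop :=
  (∀ i, (E i).Nonempty) ∧
  (∀ i j : Fin k, i < j → ∀ a ∈ E i, ∀ b ∈ E j, a < b) ∧
  Finset.image (fun i => fmin (E i)) Finset.univ ∈ 𝒮

/-- Restriction `E x` of a finitely supported vector `x` to a set `E` of coordinates. -/
noncomputable def restr (E : Finset ℕ) (x : ℕ →₀ ℝ) : ℕ →₀ ℝ :=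
  Finsupp.filter (· ∈ E) x

/-- The sup norm `‖x‖_∞` of a finitely supported vector. -/
noncomputable def fsupNorm (x : ℕ →₀ ℝ) : ℝ := ⨆ i, |x i|

/-- `Tn` is (a norm satisfying the implicit equation of) the `p`-convexified mixed
Tsirelson space `T^{(p)}[(S_n, θ_n)_{n ∈ N}]`, as a function on `c₀₀`. -/
def IsMixedTsirelsonNorm (p : ℝ) (N : Set ℕ) (θ : ℕ → ℝ) (Tn : (ℕ →₀ ℝ) → ℝ) : Prop :=
  ∀ x : ℕ →₀ ℝ,
    Tn x = max (fsupNorm x)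
      (sSup {r : ℝ | ∃ n ∈ N, ∃ (k : ℕ) (E : Fin k → Finset ℕ),
        SAdmissible (SchreierNat n) E ∧
        r = θ n ^ (1 / p) * (∑ i, Tn (restr (E i) x) ^ p) ^ (1 / p)})

/-- `Tn` is (a norm satisfying the implicit equation of) the `p`-convexified
Tsirelson-type space `T^{(p)}[S₁, θ] = T^{(p)}_θ`, as a function on `c₀₀`. -/
def IsT1Norm (p θ : ℝ) (Tn : (ℕ →₀ ℝ) → ℝ) : Prop :=
  IsMixedTsirelsonNorm p {1} (fun _ => θ) Tn

/-- Regularity of the sequence of parameters: `(θ_n) ⊂ (0,1)`, `θ_n ↘ 0` and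
`θ_{n+m} ≥ θ_n θ_m`. -/
def RegularParams (θ : ℕ → ℝ) : Prop :=
  (∀ n, 0 < θ n ∧ θ n < 1) ∧ Antitone θ ∧
    Tendsto θ atTop (nhds 0) ∧ ∀ n m, θ n * θ m ≤ θ (n + m)

section VecCore

variable {Y : Type*} [NormedAddCommGroup Y] [NormedSpace ℝ Y]

/-- The vector `∑_i a_i y_i` determined by finitely many coefficients. -/
noncomputable def vec (y : ℕ → Y) (a : ℕ →₀ ℝ) : Y := a.sum fun i c => c • y i

/-- `x` is a basic sequence: nonzero vectors satisfying the Grunblum criterion. -/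
def IsBasicSeq (x : ℕ → Y) : Prop :=
  (∀ i, x i ≠ 0) ∧
  ∃ C : ℝ, 1 ≤ C ∧ ∀ (a : ℕ → ℝ) (n m : ℕ), n ≤ m →
    ‖∑ i ∈ Finset.range n, a i • x i‖ ≤ C * ‖∑ i ∈ Finset.range m, a i • x i‖

/-- A seminormalized sequence. -/
def Seminormalized (x : ℕ → Y) : Prop :=
  ∃ c C : ℝ, 0 < c ∧ ∀ i, c ≤ ‖x i‖ ∧ ‖x i‖ ≤ C

/-- `𝒮`-unconditionality of a sequence, for a family `𝒮` of finite subsets of `ℕ`. -/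
def FUnconditional (𝒮 : Set (Finset ℕ)) (x : ℕ → Y) : Prop :=
  ∃ C : ℝ, 1 ≤ C ∧ ∀ (a : ℕ →₀ ℝ), ∀ F ∈ 𝒮,
    ‖∑ i ∈ F, a i • x i‖ ≤ C * ‖vec x a‖

/-- An unconditional sequence. -/
def UnconditionalSeq (x : ℕ → Y) : Prop :=
  ∃ C : ℝ, 1 ≤ C ∧ ∀ (a : ℕ →₀ ℝ) (F : Finset ℕ),
    ‖∑ i ∈ F, a i • x i‖ ≤ C * ‖vec x a‖

/-- The closed linear span `[y_i]` contains an isomorphic copy of `c₀`: it contains a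
sequence equivalent to the unit vector basis of `c₀`. -/
def SpanContainsC0 (y : ℕ → Y) : Prop :=
  ∃ z : ℕ → Y, (∀ k, z k ∈ closure (Submodule.span ℝ (Set.range y) : Set Y)) ∧
    ∃ c C : ℝ, 0 < c ∧ ∀ a : ℕ →₀ ℝ,
      c * (⨆ i, |a i|) ≤ ‖vec z a‖ ∧ ‖vec z a‖ ≤ C * (⨆ i, |a i|)

/-- `[y_i]` contains the spaces `c₀ⁿ` uniformly: there is `C ≥ 1` such that for every
`n` there are `n` disjointly supported vectors `C`-equivalent to the unit vector
basis of `c₀ⁿ`. -/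
def ContainsC0nUniformly (y : ℕ → Y) : Prop :=
  ∃ C : ℝ, 1 ≤ C ∧ ∀ n : ℕ, ∃ b : Fin n → (ℕ →₀ ℝ),
    (∀ j k, j ≠ k → Disjoint (b j).support (b k).support) ∧
    ∀ a : Fin n → ℝ,
      (1 / C) * (⨆ j, |a j|) ≤ ‖∑ j, a j • vec y (b j)‖ ∧
      ‖∑ j, a j • vec y (b j)‖ ≤ C * (⨆ j, |a j|)

/-- `e` is a (Schauder) basis of `Y`: nonzero vectors satisfying the Grunblum
criterion whose linear span is dense. -/
def IsSchauderBasis (e : ℕ → Y) : Prop :=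
  (∀ i, e i ≠ 0) ∧
  (∃ C : ℝ, 1 ≤ C ∧ ∀ (a : ℕ → ℝ) (n m : ℕ), n ≤ m →
    ‖∑ i ∈ Finset.range n, a i • e i‖ ≤ C * ‖∑ i ∈ Finset.range m, a i • e i‖) ∧
  Dense (Submodule.span ℝ (Set.range e) : Set Y)

/-- A family of finitely supported coefficient vectors is a block family:
nonempty successive supports. -/
def SuccBlocks {ι : Type*} [Preorder ι] (A : ι → (ℕ →₀ ℝ)) : Prop :=
  (∀ i, (A i).support.Nonempty) ∧
  ∀ i j, i < j → ∀ a ∈ (A i).support, ∀ b ∈ (A j).support, a < b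

end VecCore

section Operators

variable {E F : Type*} [NormedAddCommGroup E] [NormedSpace ℝ E]
  [NormedAddCommGroup F] [NormedSpace ℝ F]

/-- A bounded operator is strictly singular if its restriction to no
infinite-dimensional subspace is an isomorphism onto its image, i.e. it is not
bounded below on any infinite-dimensional subspace. -/
def StrictlySingular (T : E →L[ℝ] F) : Prop :=
  ∀ V : Submodule ℝ E, ¬ FiniteDimensional ℝ V →
    ¬ ∃ c : ℝ, 0 < c ∧ ∀ v ∈ V, c * ‖v‖ ≤ ‖T v‖

end Operators

/-- Every element of `A` lies below every element of `B`. -/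
def Before (A B : Finset ℕ) : Prop := ∀ a ∈ A, ∀ b ∈ B, a < b

/-- `F` is a union of `k` successive members of `SchreierNat n`. -/
def Cov (n : ℕ) : ℕ → Finset ℕ → Prop
  | 0, F => F = ∅
  | k + 1, F => ∃ A R, F = A ∪ R ∧ Before A R ∧ Cov n k A ∧ R ∈ SchreierNat n

theorem fmin_mem {s : Finset ℕ} (h : s.Nonempty) : fmin s ∈ s := by
  have := Nat.sInf_mem (s := (s : Set ℕ)) h
  simpa [fmin] using this

theorem fmin_le {s : Finset ℕ} {a : ℕ} (h : a ∈ s) : fmin s ≤ a :=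
  Nat.sInf_le (by simpa using h)

theorem mem_schreierNat_of_spread {n : ℕ} {D D' : Finset ℕ} (ψ : ℕ → ℕ)
    (hD : D ∈ SchreierNat n) (hψ : ∀ d ∈ D', ψ d ∈ D ∧ ψ d ≤ d)
    (hmono : ∀ a ∈ D', ∀ b ∈ D', a < b → ψ a < ψ b) : D' ∈ SchreierNat n := by
  induction n generalizing D D' with
  | zero =>
    have hD : D.card ≤ 1 := hD
    show D'.card ≤ 1
    refine (Finset.card_le_card_of_injOn ψ (fun d hd => (hψ d hd).1) ?_).trans hD
    intro a ha b hb hab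
    by_contra hne
    rcases lt_or_gt_of_ne hne with h | h
    · have := hmono a ha b hb h; omega
    · have := hmono b hb a ha h; omega
  | succ n ih =>
    obtain ⟨k, E, hE, hs, hk, rfl⟩ := hD
    refine ⟨k, fun i => D'.filter (fun d => ψ d ∈ E i), fun i => ?_, ?_, ?_, ?_⟩
    · refine ih (hE i) (fun d hd => ?_) (fun a ha b hb => ?_)
      · rw [mem_filter] at hd
        exact ⟨hd.2, (hψ d hd.1).2⟩
      · exact hmono a (mem_filter.1 ha).1 b (mem_filter.1 hb).1
    · intro i j hij a ha b hb
      rw [mem_filter] at ha hb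
      have h1 := hs i j hij _ ha.2 _ hb.2
      by_contra hlt
      rcases (not_lt.1 hlt).lt_or_eq with h | h
      · have := hmono b hb.1 a ha.1 h; omega
      · subst h; omega
    · intro i a ha
      rw [mem_filter] at ha
      exact (hk i _ ha.2).trans (hψ a ha.1).2
    · ext d
      simp only [mem_biUnion, mem_univ, true_and, mem_filter]
      constructor
      · intro hd
        obtain ⟨i, -, hi⟩ := mem_biUnion.1 (hψ d hd).1
        exact ⟨i, hd, hi⟩
      · rintro ⟨i, hd, -⟩; exact hd

theorem mem_schreierNat_of_rel {n : ℕ} {D D' : Finset ℕ} (r : ℕ → ℕ → Prop)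
    (hD : D ∈ SchreierNat n) (hr : ∀ d' ∈ D', ∃ d ∈ D, d ≤ d' ∧ r d' d)
    (hmono : ∀ a b c d, r a c → r b d → a < b → c < d) : D' ∈ SchreierNat n := by
  choose! ψ h1 h2 h3 using hr
  exact mem_schreierNat_of_spread ψ hD (fun d hd => ⟨h1 d hd, h2 d hd⟩)
    fun a ha b hb hab => hmono _ _ _ _ (h3 a ha) (h3 b hb) hab

theorem schreierNat_subset {n : ℕ} {D D' : Finset ℕ} (hD : D ∈ SchreierNat n)
    (h : D' ⊆ D) : D' ∈ SchreierNat n :=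
  mem_schreierNat_of_spread id hD (fun _ hd => ⟨h hd, le_rfl⟩) fun _ _ _ _ h => h

theorem empty_mem_schreierNat (n : ℕ) : ∅ ∈ SchreierNat n := by
  cases n with
  | zero => show Finset.card _ ≤ 1; simp
  | succ n => exact ⟨0, fun _ => ∅, by simp, by simp, by simp, by simp⟩

theorem cov_iff_exists_fin {n k : ℕ} {F : Finset ℕ} : Cov n k F ↔
    ∃ E : Fin k → Finset ℕ, (∀ i, E i ∈ SchreierNat n) ∧
      (∀ i j : Fin k, i < j → ∀ a ∈ E i, ∀ b ∈ E j, a < b) ∧ F = univ.biUnion E := by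
  induction k generalizing F with
  | zero =>
    constructor
    · intro h
      exact ⟨fun _ => ∅, fun i => i.elim0, fun i => i.elim0, by simpa [Cov] using h⟩
    · rintro ⟨E, -, -, rfl⟩
      simp [Cov]
  | succ k ih =>
    constructor
    · rintro ⟨A, R, rfl, hAR, hA, hR⟩
      obtain ⟨E, hE, hs, rfl⟩ := ih.1 hA
      refine ⟨Fin.snoc E R, fun i => ?_, fun i j => ?_, ?_⟩
      · refine Fin.lastCases ?_ (fun i => ?_) i
        · simpa using hR
        · simpa using hE i
      · refine Fin.lastCases (fun h => ?_) (fun i => ?_) i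
        · exact absurd h (Fin.le_last j).not_gt
        · refine Fin.lastCases (fun _ => ?_) (fun j h => ?_) j
          · simp only [Fin.snoc_castSucc, Fin.snoc_last]
            exact fun a ha b hb => hAR a (mem_biUnion.2 ⟨i, mem_univ _, ha⟩) b hb
          · simp only [Fin.snoc_castSucc]
            exact hs i j (by simpa using h)
      · ext a
        simp [Fin.exists_fin_succ', or_comm]
    · rintro ⟨E, hE, hs, rfl⟩
      refine ⟨univ.biUnion (fun i : Fin k => E i.castSucc), E (Fin.last k), ?_, ?_, ?_, hE _⟩
      · ext a
        simp [Fin.exists_fin_succ', or_comm]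
      · intro a ha b hb
        obtain ⟨i, -, hi⟩ := mem_biUnion.1 ha
        exact hs _ _ (Fin.castSucc_lt_last i) a hi b hb
      · exact ih.2 ⟨_, fun i => hE _, fun i j h => hs _ _ (by simpa using h), rfl⟩

theorem mem_schreierNat_succ {n : ℕ} {F : Finset ℕ} :
    F ∈ SchreierNat (n + 1) ↔ ∃ k, (∀ a ∈ F, k ≤ a) ∧ Cov n k F := by
  constructor
  · rintro ⟨k, E, hE, hs, hk, rfl⟩
    refine ⟨k, fun a ha => ?_, cov_iff_exists_fin.2 ⟨E, hE, hs, rfl⟩⟩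
    obtain ⟨i, -, hi⟩ := mem_biUnion.1 ha
    exact hk i a hi
  · rintro ⟨k, hk, hF⟩
    obtain ⟨E, hE, hs, rfl⟩ := cov_iff_exists_fin.1 hF
    exact ⟨k, E, hE, hs, fun i a ha => hk a (mem_biUnion.2 ⟨i, mem_univ _, ha⟩), rfl⟩

namespace Cov

variable {n k l : ℕ} {F G : Finset ℕ}

theorem empty (n k : ℕ) : Cov n k ∅ := by
  induction k with
  | zero => rfl
  | succ k ih => exact ⟨∅, ∅, by simp, by simp [Before], ih, empty_mem_schreierNat n⟩

theorem subset (h : Cov n k F) (hG : G ⊆ F) : Cov n k G := by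
  induction k generalizing F G with
  | zero => have : F = ∅ := h; subst this; exact Finset.subset_empty.1 hG
  | succ k ih =>
    obtain ⟨A, R, rfl, hAR, hA, hR⟩ := h
    refine ⟨A ∩ G, R ∩ G, ?_, fun a ha b hb => hAR a (mem_inter.1 ha).1 b (mem_inter.1 hb).1,
      ih hA inter_subset_left, schreierNat_subset hR inter_subset_left⟩
    rw [← Finset.union_inter_distrib_right, inter_eq_right.2 hG]

theorem succ (h : Cov n k F) : Cov n (k + 1) F :=
  ⟨F, ∅, by simp, by simp [Before], h, empty_mem_schreierNat n⟩

theorem mono (h : Cov n k F) (hkl : k ≤ l) : Cov n l F := by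
  induction hkl with
  | refl => exact h
  | step _ ih => exact ih.succ

theorem of_mem (h : F ∈ SchreierNat n) : Cov n 1 F :=
  ⟨∅, F, by simp, by simp [Before], empty n 0, h⟩

theorem mem_of_le (h : Cov n k F) (hk : ∀ a ∈ F, k ≤ a) : F ∈ SchreierNat (n + 1) :=
  mem_schreierNat_succ.2 ⟨k, hk, h⟩

theorem split {a b : ℕ} (h : Cov n (a + b) F) :
    ∃ A R, F = A ∪ R ∧ Before A R ∧ Cov n a A ∧ Cov n b R := by
  induction b generalizing F with
  | zero => exact ⟨F, ∅, by simp, by simp [Before], h, rfl⟩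
  | succ b ih =>
    obtain ⟨A, R, rfl, hAR, hA, hR⟩ := h
    obtain ⟨A', R', rfl, hAR', hA', hR'⟩ := ih hA
    refine ⟨A', R' ∪ R, by rw [union_assoc], ?_, hA', R', R, rfl, ?_, hR', hR⟩
    · intro c hc d hd
      rcases mem_union.1 hd with hd | hd
      · exact hAR' c hc d hd
      · exact hAR c (mem_union_left _ hc) d hd
    · exact fun c hc d hd => hAR c (mem_union_right _ hc) d hd

/-- The longest initial segment of `F` covered by `a` sets leaves a remainder covered by `b`. -/
theorem greedy {a b : ℕ} (h : Cov n (a + b) F) :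
    ∃ t, Cov n a (F.filter (· < t)) ∧ Cov n b (F.filter (t ≤ ·)) ∧
      ∀ s, Cov n a (F.filter (· < s)) → F.filter (· < s) ⊆ F.filter (· < t) := by
  classical
  set P : ℕ → Prop := fun t => Cov n a (F.filter (· < t)) with hP
  set N := F.sup id + 1 with hN
  have hFN : ∀ x ∈ F, x < N := fun x hx => Nat.lt_succ_of_le (Finset.le_sup (f := id) hx)
  have h0 : P 0 := by simpa [hP] using empty n a
  have hmax : ∀ s, P s → F.filter (· < s) ⊆ F.filter (· < Nat.findGreatest P N) := by
    intro s hs x hx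
    rw [mem_filter] at hx ⊢
    refine ⟨hx.1, ?_⟩
    rcases le_or_gt s N with hsN | hsN
    · exact hx.2.trans_le (Nat.le_findGreatest hsN hs)
    · have hPN : P N := by
        refine Cov.subset hs ?_
        exact fun y hy => by
          rw [mem_filter] at hy ⊢; exact ⟨hy.1, hy.2.trans hsN⟩
      exact (hFN x hx.1).trans_le (Nat.le_findGreatest le_rfl hPN)
  refine ⟨Nat.findGreatest P N, Nat.findGreatest_spec (P := P) (Nat.zero_le N) h0, ?_, hmax⟩
  obtain ⟨A, R, rfl, hAR, hA, hR⟩ := h.split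
  refine hR.subset fun x hx => ?_
  rw [mem_filter] at hx
  rcases mem_union.1 hx.1 with hxA | hxR
  · exfalso
    have hPx : P (x + 1) := by
      refine hA.subset fun y hy => ?_
      rw [mem_filter] at hy
      rcases mem_union.1 hy.1 with h | h
      · exact h
      · have := hAR x hxA y h; omega
    have := hmax _ hPx (mem_filter.2 ⟨hx.1, Nat.lt_succ_self x⟩)
    rw [mem_filter] at this
    omega
  · exact hxR

theorem zero_iff_card : Cov 0 k F ↔ F.card ≤ k := by
  induction k generalizing F with
  | zero => simp [Cov]
  | succ k ih =>
    constructor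
    · rintro ⟨A, R, rfl, -, hA, hR⟩
      have hR : R.card ≤ 1 := hR
      exact (card_union_le _ _).trans (add_le_add (ih.1 hA) hR)
    · intro h
      rcases F.eq_empty_or_nonempty with rfl | hne
      · exact empty _ _
      · refine ⟨F.erase (F.max' hne), {F.max' hne}, ?_, ?_, ih.2 ?_, ?_⟩
        · ext y
          simp only [mem_union, mem_erase, mem_singleton]
          constructor
          · intro hy; by_cases h : y = F.max' hne <;> simp [h, hy]
          · rintro (h | rfl)
            · exact h.2
            · exact F.max'_mem hne
        · intro a ha b hb
          rw [mem_singleton] at hb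
          rw [mem_erase] at ha
          subst hb
          exact lt_of_le_of_ne (F.le_max' a ha.2) ha.1
        · rw [card_erase_of_mem (F.max'_mem hne)]; omega
        · show Finset.card _ ≤ 1; simp

/-- The multiset `κ` controls how many members of `SchreierNat n` cover initial segments of `F`. -/
def Good (n : ℕ) (F : Finset ℕ) (κ : Multiset ℕ) : Prop :=
  ∀ t, Cov n ((κ.filter (· < t)).sum) (F.filter (· < t))

theorem Good.cov_succ {κ : Multiset ℕ} (h : Good n F κ) : Cov (n + 1) κ.card F := by
  obtain ⟨m, hm⟩ : ∃ m, κ.card = m := ⟨_, rfl⟩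
  induction m generalizing κ F with
  | zero =>
    have hκ : κ = 0 := Multiset.card_eq_zero.1 hm
    subst hκ
    have h1 : F.filter (· < F.sup id + 1) = ∅ := by simpa [Cov] using h (F.sup id + 1)
    have : F = ∅ := by
      rw [← h1, eq_comm, filter_eq_self]
      exact fun x hx => Nat.lt_succ_of_le (Finset.le_sup (f := id) hx)
    subst this
    exact empty _ _
  | succ m ih =>
    have hne : κ.toFinset.Nonempty := by
      rw [Multiset.toFinset_nonempty]
      rintro rfl
      simp at hm
    set k := κ.toFinset.max' hne with hk
    have hkmem : k ∈ κ := Multiset.mem_toFinset.1 (Finset.max'_mem _ _)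
    have hkle : ∀ i ∈ κ, i ≤ k := fun i hi => Finset.le_max' _ _ (Multiset.mem_toFinset.2 hi)
    obtain ⟨κ', hκ'⟩ := Multiset.exists_cons_of_mem hkmem
    have hall : Cov n (κ'.sum + k) F := by
      have h1 := h (F.sup id + k + 1)
      rw [Multiset.filter_eq_self.2, Finset.filter_true_of_mem] at h1
      · rwa [hκ', Multiset.sum_cons, add_comm] at h1
      · intro x hx
        have := Finset.le_sup (f := id) hx
        simp only [id] at this
        omega
      · intro i hi
        have := hkle i hi
        omega
    obtain ⟨t, hA, hR, hmax⟩ := hall.greedy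
    have hRk : ∀ a ∈ F.filter (t ≤ ·), k ≤ a := by
      intro a ha
      by_contra hlt
      have h1 : Cov n κ'.sum (F.filter (· < k)) := by
        refine (h k).mono ?_
        rw [hκ', Multiset.filter_cons_of_neg _ (by simp)]
        calc _ ≤ (κ'.filter (· < k)).sum + (κ'.filter (¬ · < k)).sum := Nat.le_add_right _ _
          _ = κ'.sum := by rw [← Multiset.sum_add, Multiset.filter_add_not]
      have := hmax k h1 (mem_filter.2 ⟨(mem_filter.1 ha).1, not_le.1 hlt⟩)
      rw [mem_filter] at this ha
      omega
    have hcard : κ.card = κ'.card + 1 := by rw [hκ', Multiset.card_cons]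
    rw [hcard]
    refine ⟨F.filter (· < t), F.filter (t ≤ ·), ?_, ?_, ih ?_ (by omega), hR.mem_of_le hRk⟩
    · ext x
      simp only [mem_union, mem_filter]
      have := lt_or_ge x t
      tauto
    · intro a ha b hb
      exact (mem_filter.1 ha).2.trans_le (mem_filter.1 hb).2
    · intro s
      rcases le_or_gt s k with hs | hs
      · have h1 := h s
        rw [hκ', Multiset.filter_cons_of_neg _ (by omega)] at h1
        exact h1.subset (filter_subset_filter _ (filter_subset _ _))
      · rw [Multiset.filter_eq_self.2]
        · exact hA.subset (filter_subset _ _)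
        · intro i hi
          have := hkle i (hκ' ▸ Multiset.mem_cons_of_mem hi)
          omega

/-- Unions of arbitrary, possibly interlaced, sets. -/
theorem union (hF : Cov n k F) (hG : Cov n l G) : Cov n (k + l) (F ∪ G) := by
  induction n generalizing k l F G with
  | zero =>
    rw [zero_iff_card] at *
    exact (card_union_le _ _).trans (add_le_add hF hG)
  | succ n ih =>
    have hadd : ∀ {F G : Finset ℕ} {κ κ' : Multiset ℕ}, Good n F κ → Good n G κ' →
        Good n (F ∪ G) (κ + κ') := by
      intro F G κ κ' h h' t
      rw [Multiset.filter_add, Multiset.sum_add, filter_union]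
      exact ih (h t) (h' t)
    have hex : ∀ {k : ℕ} {F : Finset ℕ}, Cov (n + 1) k F →
        ∃ κ : Multiset ℕ, κ.card = k ∧ Good n F κ := by
      intro k
      induction k with
      | zero =>
        intro F h
        have : F = ∅ := h
        subst this
        exact ⟨0, rfl, fun t => empty _ _⟩
      | succ k ihk =>
        rintro F ⟨A, R, rfl, -, hA, hR⟩
        obtain ⟨κ, hκ, hg⟩ := ihk hA
        obtain ⟨q, hq, hc⟩ := mem_schreierNat_succ.1 hR
        refine ⟨κ + {q}, by simp [hκ], hadd hg fun t => ?_⟩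
        by_cases hqt : q < t
        · rw [Multiset.filter_singleton, if_pos hqt, Multiset.sum_singleton]
          exact hc.subset (filter_subset _ _)
        · rw [filter_false_of_mem]
          · exact empty _ _
          · intro a ha
            have := hq a ha
            omega
    obtain ⟨κ, rfl, h⟩ := hex hF
    obtain ⟨κ', rfl, h'⟩ := hex hG
    rw [← Multiset.card_add]
    exact (hadd h h').cov_succ

end Cov

theorem schreierNat_succ_of_pos {n : ℕ} {F : Finset ℕ} (h : F ∈ SchreierNat n)
    (hpos : ∀ a ∈ F, 1 ≤ a) : F ∈ SchreierNat (n + 1) :=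
  (Cov.of_mem h).mem_of_le hpos

theorem schreierNat_mono {n m : ℕ} {F : Finset ℕ} (h : F ∈ SchreierNat n) (hnm : n ≤ m)
    (hpos : ∀ a ∈ F, 1 ≤ a) : F ∈ SchreierNat m := by
  induction hnm with
  | refl => exact h
  | step _ ih => exact schreierNat_succ_of_pos ih hpos

theorem singleton_mem_schreierNat_zero (a : ℕ) : {a} ∈ SchreierNat 0 := by
  show Finset.card _ ≤ 1
  simp

theorem biUnion_mem_schreierNat {m n : ℕ} {D : Finset ℕ} {A : ℕ → Finset ℕ}
    (hD : D ∈ SchreierNat m) (hA : ∀ d ∈ D, A d ∈ SchreierNat n)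
    (hle : ∀ d ∈ D, ∀ a ∈ A d, d ≤ a)
    (hlt : ∀ d ∈ D, ∀ d' ∈ D, d < d' → Before (A d) (A d')) :
    D.biUnion A ∈ SchreierNat (n + m) := by
  induction m generalizing D with
  | zero =>
    rcases Finset.card_le_one_iff_subset_singleton.1 hD with ⟨d, hd⟩
    rcases Finset.subset_singleton_iff.1 hd with rfl | rfl
    · simpa using empty_mem_schreierNat _
    · simpa using hA d (mem_singleton_self d)
  | succ m ih =>
    obtain ⟨k, E, hE, hs, hk, rfl⟩ := hD
    have hmem : ∀ i, ∀ d ∈ E i, d ∈ univ.biUnion E := fun i d hd =>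
      mem_biUnion.2 ⟨i, mem_univ _, hd⟩
    refine ⟨k, fun i => (E i).biUnion A, fun i => ih (hE i) (fun d hd => hA d (hmem i d hd))
      (fun d hd => hle d (hmem i d hd))
      (fun d hd d' hd' => hlt d (hmem i d hd) d' (hmem i d' hd')), ?_, ?_, ?_⟩
    · intro i j hij a ha b hb
      obtain ⟨d, hd, had⟩ := mem_biUnion.1 ha
      obtain ⟨d', hd', hbd⟩ := mem_biUnion.1 hb
      exact hlt d (hmem i d hd) d' (hmem j d' hd') (hs i j hij d hd d' hd') a had b hbd
    · intro i a ha
      obtain ⟨d, hd, had⟩ := mem_biUnion.1 ha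
      exact (hk i d hd).trans (hle d (hmem i d hd) a had)
    · ext a; simp only [mem_biUnion, mem_univ, true_and]; tauto

/-- A finite set of successive nonempty sets whose minima form a set in `SchreierNat n`. -/
def Adm (n : ℕ) (𝓔 : Finset (Finset ℕ)) : Prop :=
  (∀ A ∈ 𝓔, A.Nonempty) ∧ (∀ A ∈ 𝓔, ∀ B ∈ 𝓔, A ≠ B → Before A B ∨ Before B A) ∧
    𝓔.image fmin ∈ SchreierNat n

namespace Adm

variable {m n : ℕ} {𝓔 : Finset (Finset ℕ)}

theorem before_of_lt (h : Adm n 𝓔) {A B : Finset ℕ} (hA : A ∈ 𝓔) (hB : B ∈ 𝓔)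
    {a b : ℕ} (ha : a ∈ A) (hb : b ∈ B) (hAB : A ≠ B) (hab : a < b) : Before A B := by
  rcases h.2.1 A hA B hB hAB with h1 | h1
  · exact h1
  · exact absurd (h1 b hb a ha) hab.not_gt

theorem eq_of_mem (h : Adm n 𝓔) {A B : Finset ℕ} (hA : A ∈ 𝓔) (hB : B ∈ 𝓔)
    {a : ℕ} (ha : a ∈ A) (hb : a ∈ B) : A = B := by
  by_contra hne
  rcases h.2.1 A hA B hB hne with h1 | h1
  · exact lt_irrefl _ (h1 a ha a hb)
  · exact lt_irrefl _ (h1 a hb a ha)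

theorem fmin_inj (h : Adm n 𝓔) {A B : Finset ℕ} (hA : A ∈ 𝓔) (hB : B ∈ 𝓔)
    (heq : fmin A = fmin B) : A = B :=
  h.eq_of_mem hA hB (fmin_mem (h.1 A hA)) (heq ▸ fmin_mem (h.1 B hB))

theorem biUnion_mem (h : Adm m 𝓔) {C : Finset ℕ → Finset ℕ}
    (hC : ∀ A ∈ 𝓔, C A ∈ SchreierNat n) (hsub : ∀ A ∈ 𝓔, C A ⊆ A) :
    𝓔.biUnion C ∈ SchreierNat (n + m) := by
  have key : ∀ A ∈ 𝓔, (𝓔.filter (fun B => fmin B = fmin A)).biUnion C = C A := by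
    intro A hA
    have : 𝓔.filter (fun B => fmin B = fmin A) = {A} := by
      ext B
      simp only [mem_filter, mem_singleton]
      exact ⟨fun hB => h.fmin_inj hB.1 hA hB.2, fun hB => by subst hB; exact ⟨hA, rfl⟩⟩
    rw [this, singleton_biUnion]
  have h1 := biUnion_mem_schreierNat (n := n)
    (A := fun d => (𝓔.filter (fun B => fmin B = d)).biUnion C) h.2.2 ?_ ?_ ?_
  · convert h1 using 1
    rw [image_biUnion]
    exact Finset.biUnion_congr rfl fun A hA => (key A hA).symm
  · intro d hd
    obtain ⟨A, hA, rfl⟩ := mem_image.1 hd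
    simp only [key A hA]
    exact hC A hA
  · intro d hd a ha
    obtain ⟨A, hA, rfl⟩ := mem_image.1 hd
    simp only [key A hA] at ha
    exact fmin_le (hsub A hA ha)
  · intro d hd d' hd' hdd
    obtain ⟨A, hA, rfl⟩ := mem_image.1 hd
    obtain ⟨B, hB, rfl⟩ := mem_image.1 hd'
    simp only [key A hA, key B hB]
    have hAB := h.before_of_lt hA hB (fmin_mem (h.1 A hA)) (fmin_mem (h.1 B hB))
      (by rintro rfl; exact lt_irrefl _ hdd) hdd
    exact fun a ha b hb => hAB a (hsub A hA ha) b (hsub B hB hb)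

end Adm

/-- Removing a member of `SchreierNat (n + 1)` makes the masses of members of `SchreierNat n`
small. -/
theorem exists_removal {f : ℕ → ℝ} {n : ℕ} {η M : ℝ} {B : Finset ℕ} (hη : 0 < η)
    (hM : ∀ F ⊆ B, F ∈ SchreierNat (n + 1) → ∑ i ∈ F, f i ≤ M)
    (hB : ∀ a ∈ B, M < η * a) :
    ∃ H ⊆ B, H ∈ SchreierNat (n + 1) ∧
      ∀ F ⊆ B \ H, F ∈ SchreierNat n → ∑ i ∈ F, f i ≤ η := by
  by_contra! hcon
  have key : ∀ q : ℕ, (∀ a ∈ B, q ≤ a) ∧ ∃ H ⊆ B, Cov n q H ∧ q * η ≤ ∑ i ∈ H, f i := by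
    intro q
    induction q with
    | zero => exact ⟨fun a _ => Nat.zero_le a, ∅, by simp, Cov.empty _ _, by simp⟩
    | succ q ih =>
      obtain ⟨hq, H, hHB, hH, hsum⟩ := ih
      have hmem := hH.mem_of_le fun a ha => hq a (hHB ha)
      obtain ⟨F, hFB, hF, hFη⟩ := hcon H hHB hmem
      refine ⟨fun a ha => ?_, H ∪ F, union_subset hHB (hFB.trans sdiff_subset),
        hH.union (Cov.of_mem hF), ?_⟩
      · have h1 := hM H hHB hmem
        have h2 := hB a ha
        have : (q : ℝ) < a := by
          by_contra hle
          rw [not_lt] at hle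
          nlinarith
        exact_mod_cast this
      · rw [sum_union (disjoint_of_subset_right hFB disjoint_sdiff)]
        push_cast
        linarith
  rcases B.eq_empty_or_nonempty with rfl | ⟨a, ha⟩
  · obtain ⟨F, hF, -, h⟩ := hcon ∅ (by simp) (empty_mem_schreierNat _)
    simp only [sdiff_empty, subset_empty] at hF
    subst hF
    simp at h
    linarith
  · have := (key (a + 1)).1 a ha
    omega

theorem SAdmissible.injective {𝒮 : Set (Finset ℕ)} {k : ℕ} {E : Fin k → Finset ℕ}
    (h : SAdmissible 𝒮 E) : Function.Injective E := by
  intro i j hij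
  obtain ⟨a, ha⟩ := h.1 i
  by_contra hne
  rcases lt_or_gt_of_ne hne with hlt | hlt
  · exact lt_irrefl _ (h.2.1 i j hlt a ha a (hij ▸ ha))
  · exact lt_irrefl _ (h.2.1 j i hlt a (hij ▸ ha) a ha)

theorem SAdmissible.adm {n k : ℕ} {E : Fin k → Finset ℕ}
    (h : SAdmissible (SchreierNat n) E) : Adm n (univ.image E) := by
  refine ⟨?_, ?_, ?_⟩
  · intro A hA
    obtain ⟨i, -, rfl⟩ := mem_image.1 hA
    exact h.1 i
  · intro A hA B hB hne
    obtain ⟨i, -, rfl⟩ := mem_image.1 hA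
    obtain ⟨j, -, rfl⟩ := mem_image.1 hB
    rcases lt_trichotomy i j with hij | rfl | hij
    · exact Or.inl (h.2.1 i j hij)
    · exact absurd rfl hne
    · exact Or.inr (h.2.1 j i hij)
  · rw [image_image]
    exact h.2.2

theorem Adm.exists_fin {n : ℕ} {𝓔 : Finset (Finset ℕ)} (h : Adm n 𝓔) :
    ∃ (k : ℕ) (E : Fin k → Finset ℕ), SAdmissible (SchreierNat n) E ∧ univ.image E = 𝓔 := by
  set D := 𝓔.image fmin with hD
  have hex : ∀ i : Fin D.card, ∃ A ∈ 𝓔, fmin A = D.orderEmbOfFin rfl i := fun i =>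
    mem_image.1 (D.orderEmbOfFin_mem rfl i)
  choose E hE hmin using hex
  have himg : univ.image E = 𝓔 := by
    ext A
    simp only [mem_image, mem_univ, true_and]
    constructor
    · rintro ⟨i, rfl⟩; exact hE i
    · intro hA
      have h1 : fmin A ∈ Set.range (D.orderEmbOfFin rfl) := by
        rw [Finset.range_orderEmbOfFin]
        exact mem_image_of_mem _ hA
      obtain ⟨i, hi⟩ := h1
      exact ⟨i, h.fmin_inj (hE i) hA ((hmin i).trans hi)⟩
  refine ⟨D.card, E, ⟨fun i => h.1 _ (hE i), ?_, ?_⟩, himg⟩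
  · intro i j hij
    have hlt : fmin (E i) < fmin (E j) := by
      rw [hmin, hmin]
      exact (D.orderEmbOfFin rfl).strictMono hij
    exact h.before_of_lt (hE i) (hE j) (fmin_mem (h.1 _ (hE i))) (fmin_mem (h.1 _ (hE j)))
      (fun heq => by rw [heq] at hlt; exact lt_irrefl _ hlt) hlt
  · have : image (fun i => fmin (E i)) univ = 𝓔.image fmin := by
      rw [← himg, image_image]; rfl
    rw [this]
    exact h.2.2

theorem restr_apply (E : Finset ℕ) (v : ℕ →₀ ℝ) (i : ℕ) :
    restr E v i = if i ∈ E then v i else 0 := by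
  simp [restr, Finsupp.filter_apply]

theorem support_restr (E : Finset ℕ) (v : ℕ →₀ ℝ) :
    (restr E v).support = v.support.filter (· ∈ E) := by
  simp [restr, Finsupp.support_filter]

theorem restr_zero (E : Finset ℕ) : restr E 0 = 0 := by
  ext i; simp [restr_apply]

theorem restr_restr (E F : Finset ℕ) (v : ℕ →₀ ℝ) : restr E (restr F v) = restr (E ∩ F) v := by
  ext i
  simp only [restr_apply, mem_inter]
  split_ifs <;> simp_all

theorem restr_smul (E : Finset ℕ) (c : ℝ) (v : ℕ →₀ ℝ) : restr E (c • v) = c • restr E v := by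
  ext i
  simp only [restr_apply, Finsupp.smul_apply]
  split_ifs <;> simp

theorem restr_inter_support (E : Finset ℕ) (v : ℕ →₀ ℝ) :
    restr (E ∩ v.support) v = restr E v := by
  ext i
  simp only [restr_apply, mem_inter, Finsupp.mem_support_iff]
  by_cases h : v i = 0 <;> simp [h]

theorem restr_eq_self {E : Finset ℕ} {v : ℕ →₀ ℝ} (h : v.support ⊆ E) : restr E v = v := by
  ext i
  rw [restr_apply]
  split_ifs with hi
  · rfl
  · by_contra hne
    exact hi (h (Finsupp.mem_support_iff.2 (Ne.symm hne)))

theorem restr_eq_zero {E : Finset ℕ} {v : ℕ →₀ ℝ} (h : E ∩ v.support = ∅) : restr E v = 0 := by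
  rw [← restr_inter_support, h]
  ext i; simp [restr_apply]

theorem support_subset_of_restr_eq_self {E : Finset ℕ} {v : ℕ →₀ ℝ} (h : restr E v = v) :
    v.support ⊆ E := by
  intro i hi
  by_contra hne
  have := restr_apply E v i
  rw [h, if_neg hne] at this
  exact (Finsupp.mem_support_iff.1 hi) this

theorem abs_le_fsupNorm (v : ℕ →₀ ℝ) (i : ℕ) : |v i| ≤ fsupNorm v := by
  refine le_ciSup (f := fun i => |v i|) ?_ i
  refine ⟨∑ j ∈ v.support, |v j|, ?_⟩
  rintro _ ⟨j, rfl⟩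
  by_cases hj : j ∈ v.support
  · exact single_le_sum (f := fun j => |v j|) (fun _ _ => abs_nonneg _) hj
  · simp only [Finsupp.notMem_support_iff.1 hj, abs_zero]
    exact sum_nonneg fun _ _ => abs_nonneg _

namespace IsMixedTsirelsonNorm

variable {p : ℝ} {θ : ℕ → ℝ} {TZ : (ℕ →₀ ℝ) → ℝ}

theorem nonneg (h : IsMixedTsirelsonNorm p Set.univ θ TZ) (v : ℕ →₀ ℝ) : 0 ≤ TZ v := by
  rw [h v]
  exact le_max_of_le_left (Real.iSup_nonneg fun _ => abs_nonneg _)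

theorem abs_le (h : IsMixedTsirelsonNorm p Set.univ θ TZ) (v : ℕ →₀ ℝ) (i : ℕ) :
    |v i| ≤ TZ v := by
  rw [h v]
  exact le_max_of_le_left (abs_le_fsupNorm v i)

theorem map_zero (h : IsMixedTsirelsonNorm p Set.univ θ TZ) (hp : 1 ≤ p) (hθ : RegularParams θ) :
    TZ 0 = 0 := by
  by_contra hne
  have hp0 : 0 < p := by linarith
  have hpos : 0 < TZ 0 := lt_of_le_of_ne (h.nonneg 0) (Ne.symm hne)
  have hsup : fsupNorm 0 = 0 := by simp [fsupNorm]
  have h0 := h 0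
  simp only [hsup, restr_zero] at h0
  set S : Set ℝ := {r : ℝ | ∃ n ∈ Set.univ, ∃ (k : ℕ) (E : Fin k → Finset ℕ),
    SAdmissible (SchreierNat n) E ∧ r = θ n ^ (1 / p) * (∑ _i : Fin k, TZ 0 ^ p) ^ (1 / p)}
    with hS
  have hbdd : BddAbove S := by
    by_contra hb
    rw [Real.sSup_of_not_bddAbove hb, max_self] at h0
    exact hne h0
  obtain ⟨M, hM⟩ := hbdd
  have hc : 0 < θ 1 * TZ 0 ^ p := mul_pos (hθ.1 1).1 (Real.rpow_pos_of_pos hpos _)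
  obtain ⟨k, hk⟩ := exists_nat_gt (M ^ p / (θ 1 * TZ 0 ^ p))
  have hmem : θ 1 ^ (1 / p) * (∑ _i : Fin k, TZ 0 ^ p) ^ (1 / p) ∈ S := by
    refine ⟨1, trivial, k, fun i => {k + i.1}, ⟨by simp, by simp, ?_⟩, rfl⟩
    refine Cov.mem_of_le (k := k) (Cov.zero_iff_card.2 ?_) ?_
    · exact (card_image_le).trans (by simp)
    · intro a ha
      obtain ⟨i, -, rfl⟩ := mem_image.1 ha
      have := mem_singleton.1 (fmin_mem (s := {k + i.1}) (singleton_nonempty _))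
      simp only [this]
      omega
  have hle := hM hmem
  simp only [sum_const, card_univ, Fintype.card_fin, nsmul_eq_mul] at hle
  rw [← Real.mul_rpow (hθ.1 1).1.le (by positivity)] at hle
  have h1 := Real.rpow_le_rpow (by have := (hθ.1 1).1; positivity) hle hp0.le
  rw [← Real.rpow_mul (by have := (hθ.1 1).1; positivity), one_div,
    inv_mul_cancel₀ hp0.ne', Real.rpow_one] at h1
  rw [div_lt_iff₀ hc] at hk
  linarith

theorem sum_fin_eq {n k : ℕ} {E : Fin k → Finset ℕ} (hE : SAdmissible (SchreierNat n) E)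
    (v : ℕ →₀ ℝ) : ∑ i, TZ (restr (E i) v) ^ p =
      ∑ A ∈ univ.image E, TZ (restr A v) ^ p :=
  (sum_image (f := fun A => TZ (restr A v) ^ p) fun _ _ _ _ h => hE.injective h).symm

theorem sum_le (h : IsMixedTsirelsonNorm p Set.univ θ TZ) (hp : 1 ≤ p) (hθ : RegularParams θ)
    {n : ℕ} {𝓔 : Finset (Finset ℕ)} (hA : Adm n 𝓔) (v : ℕ →₀ ℝ) :
    ∑ A ∈ 𝓔, TZ (restr A v) ^ p ≤ ∑ G ∈ v.support.powerset, TZ (restr G v) ^ p := by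
  have hp0 : 0 < p := by linarith
  have hnn : ∀ A, 0 ≤ TZ (restr A v) ^ p := fun A => Real.rpow_nonneg (h.nonneg _) _
  set 𝓕 := 𝓔.filter (fun A => (A ∩ v.support).Nonempty) with h𝓕
  have h1 : ∑ A ∈ 𝓔, TZ (restr A v) ^ p = ∑ A ∈ 𝓕, TZ (restr A v) ^ p := by
    rw [h𝓕, sum_filter_of_ne]
    intro A _ hne
    by_contra hemp
    rw [restr_eq_zero (not_nonempty_iff_eq_empty.1 hemp), h.map_zero hp hθ,
      Real.zero_rpow hp0.ne'] at hne
    exact hne rfl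
  have hinj : ∀ A ∈ 𝓕, ∀ B ∈ 𝓕, A ∩ v.support = B ∩ v.support → A = B := by
    intro A hA' B hB' heq
    rw [h𝓕, mem_filter] at hA' hB'
    obtain ⟨a, ha⟩ := hA'.2
    have hb := heq ▸ ha
    exact hA.eq_of_mem hA'.1 hB'.1 (mem_inter.1 ha).1 (mem_inter.1 hb).1
  rw [h1]
  calc ∑ A ∈ 𝓕, TZ (restr A v) ^ p = ∑ A ∈ 𝓕, TZ (restr (A ∩ v.support) v) ^ p := by
        simp only [restr_inter_support]
    _ = ∑ G ∈ 𝓕.image (· ∩ v.support), TZ (restr G v) ^ p := by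
        rw [sum_image]
        exact fun A hA B hB heq => hinj A hA B hB heq
    _ ≤ _ := by
        refine sum_le_sum_of_subset_of_nonneg ?_ fun G _ _ => hnn G
        intro G hG
        obtain ⟨A, -, rfl⟩ := mem_image.1 hG
        exact mem_powerset.2 inter_subset_right

theorem le_rpow (h : IsMixedTsirelsonNorm p Set.univ θ TZ) (hp : 1 ≤ p) (hθ : RegularParams θ)
    {n : ℕ} {𝓔 : Finset (Finset ℕ)} (hA : Adm n 𝓔) (v : ℕ →₀ ℝ) :
    θ n * ∑ A ∈ 𝓔, TZ (restr A v) ^ p ≤ TZ v ^ p := by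
  have hp0 : 0 < p := by linarith
  have hnn : ∀ A, 0 ≤ TZ (restr A v) ^ p := fun A => Real.rpow_nonneg (h.nonneg _) _
  obtain ⟨k, E, hE, rfl⟩ := hA.exists_fin
  have hθn := (hθ.1 n).1
  have hle : θ n ^ (1 / p) * (∑ A ∈ univ.image E, TZ (restr A v) ^ p) ^ (1 / p) ≤ TZ v := by
    rw [h v]
    refine le_max_of_le_right (le_csSup ?_ ⟨n, trivial, k, E, hE, by rw [sum_fin_eq hE]⟩)
    refine ⟨(∑ G ∈ v.support.powerset, TZ (restr G v) ^ p) ^ (1 / p), ?_⟩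
    rintro r ⟨m, -, l, E', hE', rfl⟩
    rw [sum_fin_eq hE']
    have h1 := Real.rpow_le_rpow (sum_nonneg fun A _ => hnn A)
      (h.sum_le hp hθ hE'.adm v) (one_div_pos.2 hp0).le
    have h2 : θ m ^ (1 / p) ≤ 1 :=
      Real.rpow_le_one (hθ.1 m).1.le (hθ.1 m).2.le (one_div_pos.2 hp0).le
    calc _ ≤ 1 * (∑ A ∈ univ.image E', TZ (restr A v) ^ p) ^ (1 / p) :=
          mul_le_mul_of_nonneg_right h2 (Real.rpow_nonneg (sum_nonneg fun A _ => hnn A) _)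
      _ ≤ _ := by rw [one_mul]; exact h1
  have hs : 0 ≤ ∑ A ∈ univ.image E, TZ (restr A v) ^ p := sum_nonneg fun A _ => hnn A
  rw [← Real.mul_rpow hθn.le hs] at hle
  have h1 := Real.rpow_le_rpow (by positivity) hle hp0.le
  rwa [← Real.rpow_mul (by positivity), one_div, inv_mul_cancel₀ hp0.ne', Real.rpow_one] at h1

theorem rpow_le (h : IsMixedTsirelsonNorm p Set.univ θ TZ) (hp : 1 ≤ p) (hθ : RegularParams θ)
    {v : ℕ →₀ ℝ} {B : ℝ} (hB : ∀ i, |v i| ^ p ≤ B)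
    (hB' : ∀ n 𝓔, Adm n 𝓔 → (∀ A ∈ 𝓔, restr A v ≠ v) →
      θ n * ∑ A ∈ 𝓔, TZ (restr A v) ^ p ≤ B) : TZ v ^ p ≤ B := by
  have hp0 : 0 < p := by linarith
  have hnn : ∀ A, 0 ≤ TZ (restr A v) ^ p := fun A => Real.rpow_nonneg (h.nonneg _) _
  have hB0 : 0 ≤ B := (Real.rpow_nonneg (abs_nonneg (v 0)) p).trans (hB 0)
  by_cases hv : v = 0
  · rw [hv, h.map_zero hp hθ, Real.zero_rpow hp0.ne']; exact hB0
  have hpos : 0 < TZ v := by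
    obtain ⟨i, hi⟩ := Finsupp.ne_iff.1 hv
    exact (abs_pos.2 hi).trans_le (h.abs_le v i)
  have hq : ∀ {a b : ℝ}, 0 ≤ a → a ^ p ≤ b → a ≤ b ^ (1 / p) := by
    intro a b ha hab
    have h1 := Real.rpow_le_rpow (Real.rpow_nonneg ha _) hab (one_div_pos.2 hp0).le
    rwa [← Real.rpow_mul ha, mul_one_div_cancel hp0.ne', Real.rpow_one] at h1
  have hlt : θ 0 ^ (1 / p) * TZ v < TZ v := by
    have : θ 0 ^ (1 / p) < 1 :=
      Real.rpow_lt_one (hθ.1 0).1.le (hθ.1 0).2 (one_div_pos.2 hp0)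
    nlinarith
  have hle : TZ v ≤ max (B ^ (1 / p)) (θ 0 ^ (1 / p) * TZ v) := by
    conv_lhs => rw [h v]
    refine max_le (le_max_of_le_left (ciSup_le fun i => hq (abs_nonneg _) (hB i)))
      (Real.sSup_le ?_ (le_max_of_le_left (Real.rpow_nonneg hB0 _)))
    rintro r ⟨n, -, k, E, hE, rfl⟩
    rw [sum_fin_eq hE]
    by_cases hne : ∀ A ∈ univ.image E, restr A v ≠ v
    · refine le_max_of_le_left ?_
      rw [← Real.mul_rpow (hθ.1 n).1.le (sum_nonneg fun A _ => hnn A)]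
      exact Real.rpow_le_rpow (mul_nonneg (hθ.1 n).1.le (sum_nonneg fun A _ => hnn A))
        (hB' n _ hE.adm hne) (one_div_pos.2 hp0).le
    · push Not at hne
      obtain ⟨A, hA, hAv⟩ := hne
      refine le_max_of_le_right ?_
      have hsum : ∑ A ∈ univ.image E, TZ (restr A v) ^ p = TZ v ^ p := by
        rw [sum_eq_single_of_mem A hA, hAv]
        intro B hBm hBA
        have hemp : B ∩ v.support = ∅ := by
          rw [← not_nonempty_iff_eq_empty]
          rintro ⟨a, ha⟩
          rw [mem_inter] at ha
          exact hBA (hE.adm.eq_of_mem hBm hA ha.1 (support_subset_of_restr_eq_self hAv ha.2))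
        rw [restr_eq_zero hemp, h.map_zero hp hθ, Real.zero_rpow hp0.ne']
      rw [hsum, ← Real.rpow_mul hpos.le, mul_one_div_cancel hp0.ne', Real.rpow_one]
      exact mul_le_mul_of_nonneg_right (Real.rpow_le_rpow (hθ.1 n).1.le
        (hθ.2.1 (Nat.zero_le n)) (one_div_pos.2 hp0).le) hpos.le
  rcases le_max_iff.1 hle with h1 | h1
  · have h2 := Real.rpow_le_rpow hpos.le h1 hp0.le
    rwa [← Real.rpow_mul hB0, one_div, inv_mul_cancel₀ hp0.ne', Real.rpow_one] at h2
  · exact absurd h1 hlt.not_ge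

end IsMixedTsirelsonNorm

open scoped ENNReal

/-- The `p`-th power of the modulus of a coordinate. -/
noncomputable def mass (p : ℝ) (b : ℕ →₀ ℝ) (i : ℕ) : ℝ≥0∞ := ENNReal.ofReal (|b i| ^ p)

/-- The `p`-th power of the Tsirelson norm. -/
noncomputable def tpow (p : ℝ) (TZ : (ℕ →₀ ℝ) → ℝ) (b : ℕ →₀ ℝ) : ℝ≥0∞ :=
  ENNReal.ofReal (TZ b ^ p)

/-- The largest mass of a member of `SchreierNat n`. -/
noncomputable def gmass (p : ℝ) (n : ℕ) (b : ℕ →₀ ℝ) : ℝ≥0∞ :=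
  ⨆ F : SchreierNat n, ∑ i ∈ F.1, mass p b i

/-- The total mass. -/
noncomputable def lmass (p : ℝ) (b : ℕ →₀ ℝ) : ℝ≥0∞ := ∑ i ∈ b.support, mass p b i

theorem add_sum_iSup_le {α ι : Type*} [Nonempty ι] {s : Finset α} {f : α → ι → ℝ≥0∞}
    {c B : ℝ≥0∞} (h : ∀ g : α → ι, c + ∑ a ∈ s, f a (g a) ≤ B) :
    c + ∑ a ∈ s, ⨆ j, f a j ≤ B := by
  classical
  induction s using Finset.induction_on generalizing c with
  | empty => simpa using h fun _ => Classical.arbitrary ι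
  | insert a s ha ih =>
    rw [sum_insert ha, ← add_assoc, ENNReal.add_iSup, ENNReal.iSup_add]
    refine iSup_le fun j => ih fun g => ?_
    have h1 := h (Function.update g a j)
    rw [sum_insert ha, Function.update_self, ← add_assoc] at h1
    convert h1 using 2
    refine sum_congr rfl fun b hb => ?_
    rw [Function.update_of_ne (by rintro rfl; exact ha hb)]

theorem sum_iSup_le {α ι : Type*} [Nonempty ι] {s : Finset α} {f : α → ι → ℝ≥0∞}
    {B : ℝ≥0∞} (h : ∀ g : α → ι, ∑ a ∈ s, f a (g a) ≤ B) :
    ∑ a ∈ s, ⨆ j, f a j ≤ B := by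
  simpa using add_sum_iSup_le (c := 0) (by simpa using h)

instance (n : ℕ) : Nonempty (SchreierNat n) := ⟨⟨∅, empty_mem_schreierNat n⟩⟩

theorem mass_restr {p : ℝ} (hp : 1 ≤ p) (A : Finset ℕ) (b : ℕ →₀ ℝ) (i : ℕ) :
    mass p (restr A b) i = if i ∈ A then mass p b i else 0 := by
  rw [mass, mass, restr_apply]
  split_ifs
  · rfl
  · rw [abs_zero, Real.zero_rpow (by linarith), ENNReal.ofReal_zero]

theorem Adm.sum_sum {m : ℕ} {𝓔 : Finset (Finset ℕ)} (h : Adm m 𝓔) (C : Finset ℕ → Finset ℕ)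
    (hC : ∀ A ∈ 𝓔, C A ⊆ A) (f : ℕ → ℝ≥0∞) :
    ∑ A ∈ 𝓔, ∑ i ∈ C A, f i = ∑ i ∈ 𝓔.biUnion C, f i := by
  rw [sum_biUnion]
  intro A hA B hB hne
  refine Finset.disjoint_left.2 fun a ha hb => hne ?_
  exact h.eq_of_mem hA hB (hC A hA ha) (hC B hB hb)

theorem Adm.sum_gmass_le {p : ℝ} (hp : 1 ≤ p) {m : ℕ} {𝓔 : Finset (Finset ℕ)} (h : Adm m 𝓔)
    (n : ℕ) (b : ℕ →₀ ℝ) : ∑ A ∈ 𝓔, gmass p n (restr A b) ≤ gmass p (n + m) b := by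
  refine sum_iSup_le fun g => ?_
  have hs : ∀ A, ∑ i ∈ (g A).1, mass p (restr A b) i = ∑ i ∈ (g A).1 ∩ A, mass p b i := by
    intro A
    simp only [mass_restr hp]
    rw [sum_ite_mem]
  simp only [hs]
  rw [h.sum_sum (fun A => (g A).1 ∩ A) fun A _ => inter_subset_right]
  exact le_iSup (fun F : SchreierNat (n + m) => ∑ i ∈ F.1, mass p b i)
    ⟨_, h.biUnion_mem (fun A _ => schreierNat_subset (g A).2 inter_subset_left)
      fun A _ => inter_subset_right⟩

theorem Adm.sum_lmass_le {p : ℝ} (hp : 1 ≤ p) {m : ℕ} {𝓔 : Finset (Finset ℕ)} (h : Adm m 𝓔)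
    (b : ℕ →₀ ℝ) : ∑ A ∈ 𝓔, lmass p (restr A b) ≤ lmass p b := by
  have hs : ∀ A, lmass p (restr A b) = ∑ i ∈ b.support ∩ A, mass p b i := by
    intro A
    rw [lmass, support_restr, filter_mem_eq_inter]
    refine sum_congr rfl fun i hi => ?_
    rw [mass_restr hp, if_pos (mem_inter.1 hi).2]
  simp only [hs]
  rw [h.sum_sum (fun A => b.support ∩ A) fun A _ => inter_subset_right]
  refine sum_le_sum_of_subset fun i hi => ?_
  obtain ⟨A, -, hA⟩ := mem_biUnion.1 hi
  exact (mem_inter.1 hA).1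

theorem mass_le_gmass {p : ℝ} {n : ℕ} {b : ℕ →₀ ℝ} {F : Finset ℕ} (hF : F ∈ SchreierNat n) :
    ∑ i ∈ F, mass p b i ≤ gmass p n b :=
  le_iSup (fun F : SchreierNat n => ∑ i ∈ F.1, mass p b i) ⟨F, hF⟩

theorem mass_le_lmass {p : ℝ} (hp : 1 ≤ p) (b : ℕ →₀ ℝ) (i : ℕ) : mass p b i ≤ lmass p b := by
  by_cases hi : i ∈ b.support
  · exact single_le_sum (f := mass p b) (fun _ _ => zero_le) hi
  · rw [mass, Finsupp.notMem_support_iff.1 hi, abs_zero, Real.zero_rpow (by linarith),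
      ENNReal.ofReal_zero]
    exact zero_le

section tpow

variable {p : ℝ} {θ : ℕ → ℝ} {TZ : (ℕ →₀ ℝ) → ℝ}

theorem Adm.mul_sum_tpow_le (h : IsMixedTsirelsonNorm p Set.univ θ TZ) (hp : 1 ≤ p)
    (hθ : RegularParams θ) {n : ℕ} {𝓔 : Finset (Finset ℕ)} (hA : Adm n 𝓔) (v : ℕ →₀ ℝ) :
    ENNReal.ofReal (θ n) * ∑ A ∈ 𝓔, tpow p TZ (restr A v) ≤ tpow p TZ v := by
  simp only [tpow]
  rw [← ENNReal.ofReal_sum_of_nonneg fun A _ => Real.rpow_nonneg (h.nonneg _) _,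
    ← ENNReal.ofReal_mul (hθ.1 n).1.le]
  exact ENNReal.ofReal_le_ofReal (h.le_rpow hp hθ hA v)

theorem tpow_le (h : IsMixedTsirelsonNorm p Set.univ θ TZ) (hp : 1 ≤ p)
    (hθ : RegularParams θ) {v : ℕ →₀ ℝ} {B : ℝ≥0∞} (hB : ∀ i, mass p v i ≤ B)
    (hB' : ∀ n 𝓔, Adm n 𝓔 → (∀ A ∈ 𝓔, restr A v ≠ v) →
      ENNReal.ofReal (θ n) * ∑ A ∈ 𝓔, tpow p TZ (restr A v) ≤ B) : tpow p TZ v ≤ B := by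
  by_cases hBt : B = ∞
  · rw [hBt]; exact le_top
  refine ENNReal.ofReal_le_of_le_toReal (h.rpow_le hp hθ (fun i => ?_) fun n 𝓔 hA hne => ?_)
  · exact (ENNReal.ofReal_le_iff_le_toReal hBt).1 (hB i)
  · have h1 := hB' n 𝓔 hA hne
    simp only [tpow] at h1
    rw [← ENNReal.ofReal_sum_of_nonneg fun A _ => Real.rpow_nonneg (h.nonneg _) _,
      ← ENNReal.ofReal_mul (hθ.1 n).1.le] at h1
    exact (ENNReal.ofReal_le_iff_le_toReal hBt).1 h1

/-- Comparison of the Tsirelson norm with an arbitrary functional satisfying lower estimates. -/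
theorem tpow_le_gmass_add (h : IsMixedTsirelsonNorm p Set.univ θ TZ) (hp : 1 ≤ p)
    (hθ : RegularParams θ) {N : (ℕ →₀ ℝ) → ℝ≥0∞} {ρ K : ℝ≥0∞} {n n' : ℕ}
    (hN : ∀ b i, (∀ i ∈ b.support, 1 ≤ i) → mass p b i ≤ N b)
    (hN' : ∀ m 𝓔 b, (∀ i ∈ b.support, 1 ≤ i) → Adm m 𝓔 →
      ρ ^ m * ∑ A ∈ 𝓔, N (restr A b) ≤ N b)
    (hK : ∀ l, n < l → l ≤ n' → ENNReal.ofReal (θ l) ≤ K * ρ ^ l)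
    (b : ℕ →₀ ℝ) (hb : ∀ i ∈ b.support, 1 ≤ i) :
    tpow p TZ b ≤ gmass p n b + K * N b + ENNReal.ofReal (θ n') * lmass p b := by
  set c : ℕ → ℝ≥0∞ := fun t => if t = 0 then 1 else ENNReal.ofReal (θ t) with hc
  have hc1 : ∀ t, c t ≤ 1 := by
    intro t
    simp only [hc]
    split_ifs
    · exact le_rfl
    · exact ENNReal.ofReal_le_one.2 (hθ.1 t).2.le
  have hc0 : ∀ t, c t ≠ 0 := by
    intro t
    simp only [hc]
    split_ifs
    · exact one_ne_zero
    · exact (ENNReal.ofReal_pos.2 (hθ.1 t).1).ne'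
  have hctop : ∀ t, c t ≠ ∞ := fun t => ((hc1 t).trans_lt ENNReal.one_lt_top).ne
  have hcpos : ∀ t, 0 < t → c t = ENNReal.ofReal (θ t) := fun t ht => by simp [hc, ht.ne']
  have hcadd : ∀ t m, c t * ENNReal.ofReal (θ m) ≤ c (t + m) := by
    intro t m
    rcases Nat.eq_zero_or_pos t with rfl | ht
    · rcases Nat.eq_zero_or_pos m with rfl | hm
      · simpa [hc] using (hθ.1 0).2.le
      · rw [zero_add, hcpos m hm]; simp [hc]
    · rw [hcpos t ht, hcpos _ (by omega), ← ENNReal.ofReal_mul (hθ.1 t).1.le]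
      exact ENNReal.ofReal_le_ofReal (hθ.2.2.2 t m)
  set G : ℕ → (ℕ →₀ ℝ) → ℝ≥0∞ := fun t b => if t ≤ n then gmass p (n - t) b else 0 with hG
  have main : ∀ s : ℕ, ∀ b : ℕ →₀ ℝ, b.support.card = s → (∀ i ∈ b.support, 1 ≤ i) → ∀ t,
      c t * tpow p TZ b ≤ G t b + K * (ρ ^ t * N b) + ENNReal.ofReal (θ n') * lmass p b := by
    intro s
    induction s using Nat.strong_induction_on with
    | _ s ih =>
    intro b hbs hb t
    rw [mul_comm, ← ENNReal.le_div_iff_mul_le (Or.inl (hc0 t)) (Or.inl (hctop t))]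
    refine tpow_le h hp hθ (fun i => ?_) (fun m 𝓔 hA hne => ?_)
    · rw [ENNReal.le_div_iff_mul_le (Or.inl (hc0 t)) (Or.inl (hctop t)), mul_comm]
      by_cases hi : i ∈ b.support
      swap
      · rw [mass, Finsupp.notMem_support_iff.1 hi, abs_zero, Real.zero_rpow (by linarith),
          ENNReal.ofReal_zero, mul_zero]
        exact zero_le
      rcases le_or_gt t n with ht | ht
      · refine le_add_right (le_add_right ?_)
        simp only [hG, if_pos ht]
        have hmem : {i} ∈ SchreierNat (n - t) :=
          schreierNat_mono (singleton_mem_schreierNat_zero i) (Nat.zero_le _)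
            fun a ha => by rw [mem_singleton.1 ha]; exact hb i hi
        calc c t * mass p b i ≤ 1 * mass p b i := by gcongr; exact hc1 t
          _ = ∑ j ∈ {i}, mass p b j := by rw [one_mul, sum_singleton]
          _ ≤ _ := mass_le_gmass hmem
      · rcases le_or_gt t n' with ht' | ht'
        · refine le_add_right (le_add_left ?_)
          rw [hcpos t (by omega), ← mul_assoc]
          gcongr
          · exact hK t ht ht'
          · exact hN b i hb
        · refine le_add_left ?_
          rw [hcpos t (by omega)]
          gcongr
          · exact hθ.2.1 ht'.le
          · exact mass_le_lmass hp b i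
    · rw [ENNReal.le_div_iff_mul_le (Or.inl (hc0 t)) (Or.inl (hctop t)), mul_comm, ← mul_assoc,
        mul_sum]
      have hterm : ∀ A ∈ 𝓔, c t * ENNReal.ofReal (θ m) * tpow p TZ (restr A b) ≤
          G (t + m) (restr A b) + K * (ρ ^ (t + m) * N (restr A b)) +
            ENNReal.ofReal (θ n') * lmass p (restr A b) := by
        intro A hA'
        refine (mul_le_mul_left (hcadd t m) _).trans (ih _ ?_ (restr A b) rfl ?_ (t + m))
        · rw [← hbs]
          refine card_lt_card ⟨?_, fun hss => hne A hA' ?_⟩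
          · rw [support_restr]; exact filter_subset _ _
          · rw [support_restr] at hss
            exact restr_eq_self fun i hi => (mem_filter.1 (hss hi)).2
        · intro i hi
          rw [support_restr] at hi
          exact hb i (mem_filter.1 hi).1
      refine (sum_le_sum hterm).trans ?_
      rw [sum_add_distrib, sum_add_distrib, ← mul_sum, ← mul_sum, ← mul_sum]
      gcongr ?_ + ?_ + _ * ?_
      · simp only [hG]
        by_cases htm : t + m ≤ n
        · rw [if_pos (by omega : t ≤ n)]
          simp only [if_pos htm]
          have := hA.sum_gmass_le hp (n - (t + m)) b
          rwa [show n - (t + m) + m = n - t by omega] at this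
        · simp [if_neg htm]
      · rw [pow_add, mul_assoc]
        gcongr
        exact hN' m 𝓔 b hb hA
      · exact hA.sum_lmass_le hp b
  have := main _ b rfl hb 0
  simpa [hc, hG] using this

end tpow

namespace RegularParams

variable {θ : ℕ → ℝ} {t : ℝ}

theorem limit_pos (h : RegularParams θ)
    (hlim : Tendsto (fun n : ℕ => θ n ^ (1 / (n : ℝ))) atTop (nhds t)) : 0 < t := by
  have hpow : ∀ n, θ 1 ^ (n + 1) ≤ θ (n + 1) := by
    intro n
    induction n with
    | zero => simp
    | succ n ih =>
      calc θ 1 ^ (n + 1 + 1) = θ 1 ^ (n + 1) * θ 1 := pow_succ _ _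
        _ ≤ θ (n + 1) * θ 1 := mul_le_mul_of_nonneg_right ih (h.1 1).1.le
        _ ≤ _ := h.2.2.2 _ _
  refine (h.1 1).1.trans_le (ge_of_tendsto hlim ?_)
  filter_upwards [eventually_ge_atTop 1] with n hn
  obtain ⟨m, rfl⟩ : ∃ m, n = m + 1 := ⟨n - 1, by omega⟩
  have h1 := Real.rpow_le_rpow (pow_nonneg (h.1 1).1.le _) (hpow m)
    (by positivity : 0 ≤ 1 / ((m + 1 : ℕ) : ℝ))
  rwa [one_div, Real.pow_rpow_inv_natCast (h.1 1).1.le (by omega), ← one_div] at h1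

theorem tsum_lt_top (h : RegularParams θ)
    (hlim : Tendsto (fun n : ℕ => θ n ^ (1 / (n : ℝ))) atTop (nhds t))
    {ρ : ℝ} (hρ : 0 < ρ) (hρt : ρ < t) :
    ∑' j, ENNReal.ofReal ρ ^ j / ENNReal.ofReal (θ j) < ∞ := by
  obtain ⟨σ, hσ1, hσ2⟩ := exists_between hρt
  have hσ0 : 0 < σ := hρ.trans hσ1
  have hev : ∀ᶠ j : ℕ in atTop, σ ^ j ≤ θ j := by
    filter_upwards [hlim.eventually_const_lt hσ2, eventually_ge_atTop 1] with j hj hj1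
    have h1 := pow_le_pow_left₀ hσ0.le hj.le j
    rwa [one_div, Real.rpow_inv_natCast_pow (h.1 j).1.le (by omega)] at h1
  have hs : Summable fun j => ρ ^ j / θ j := by
    refine Summable.of_norm_bounded_eventually_nat
      (summable_geometric_of_lt_one (r := ρ / σ) (by positivity) ((div_lt_one hσ0).2 hσ1)) ?_
    filter_upwards [hev] with j hj
    have := (h.1 j).1
    rw [Real.norm_of_nonneg (by positivity), div_pow]
    exact div_le_div_of_nonneg_left (by positivity) (by positivity) hj
  have heq : ∀ j, ENNReal.ofReal ρ ^ j / ENNReal.ofReal (θ j) = ENNReal.ofReal (ρ ^ j / θ j) := by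
    intro j
    rw [ENNReal.ofReal_div_of_pos (h.1 j).1, ENNReal.ofReal_pow hρ.le]
  simp only [heq]
  rw [← ENNReal.ofReal_tsum_of_nonneg (fun j => by have := (h.1 j).1; positivity) hs]
  exact ENNReal.ofReal_lt_top

end RegularParams

section lower

variable {X : Type*} [NormedAddCommGroup X] [NormedSpace ℝ X]

theorem vec_eq (x : ℕ → X) (a : ℕ →₀ ℝ) : vec x a = Finsupp.linearCombination ℝ x a := rfl

theorem vec_smul (x : ℕ → X) (c : ℝ) (a : ℕ →₀ ℝ) : vec x (c • a) = c • vec x a := by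
  simp only [vec_eq, map_smul]

theorem vec_restr (x : ℕ → X) (F : Finset ℕ) (a : ℕ →₀ ℝ) :
    vec x (restr F a) = ∑ i ∈ F, a i • x i := by
  rw [vec, Finsupp.sum_of_support_subset (s := F)]
  · refine sum_congr rfl fun i hi => ?_
    rw [restr_apply, if_pos hi]
  · rw [support_restr]
    exact fun i hi => (mem_filter.1 hi).2
  · intro i _
    exact zero_smul _ _

/-- The `p`-th power of the norm of the vector with given coefficients. -/
noncomputable def vpow (p : ℝ) (x : ℕ → X) (v : ℕ →₀ ℝ) : ℝ≥0∞ :=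
  ENNReal.ofReal (‖vec x v‖ ^ p)

theorem vpow_smul {p : ℝ} (x : ℕ → X) (c : ℝ) (v : ℕ →₀ ℝ) :
    vpow p x (c • v) = ENNReal.ofReal (|c| ^ p) * vpow p x v := by
  rw [vpow, vec_smul, norm_smul, Real.norm_eq_abs,
    Real.mul_rpow (abs_nonneg _) (norm_nonneg _),
    ENNReal.ofReal_mul (Real.rpow_nonneg (abs_nonneg _) _), vpow]

theorem vpow_zero {p : ℝ} (hp : 1 ≤ p) (x : ℕ → X) : vpow p x 0 = 0 := by
  have : vec x 0 = 0 := by simp [vec]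
  rw [vpow, this, norm_zero, Real.zero_rpow (by linarith), ENNReal.ofReal_zero]

/-- The supremum of `ℓ_p`-sums over admissible families of restrictions. -/
noncomputable def admSup (p : ℝ) (x : ℕ → X) (j : ℕ) (v : ℕ →₀ ℝ) : ℝ≥0∞ :=
  ⨆ 𝓔 : {𝓔 // Adm j 𝓔}, ∑ A ∈ 𝓔.1, vpow p x (restr A v)

/-- A functional dominating `vpow` that satisfies lower estimates with ratio `ρ`. -/
noncomputable def lowerFun (p : ℝ) (x : ℕ → X) (ρ : ℝ≥0∞) (v : ℕ →₀ ℝ) : ℝ≥0∞ :=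
  ∑' j, ρ ^ j * admSup p x j v

theorem adm_empty (j : ℕ) : Adm j ∅ :=
  ⟨by simp, by simp, by simpa using empty_mem_schreierNat j⟩

instance (j : ℕ) : Nonempty {𝓔 // Adm j 𝓔} := ⟨⟨∅, adm_empty j⟩⟩

theorem adm_singleton {A : Finset ℕ} (hA : A.Nonempty) : Adm 0 {A} := by
  refine ⟨by simpa using hA, ?_, ?_⟩
  · intro B hB C hC hne
    rw [mem_singleton] at hB hC
    exact absurd (hB.trans hC.symm) hne
  · rw [image_singleton]
    exact singleton_mem_schreierNat_zero _

theorem Adm.sum_le_admSup {p : ℝ} {x : ℕ → X} {j : ℕ} {𝓔 : Finset (Finset ℕ)} (h : Adm j 𝓔)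
    (v : ℕ →₀ ℝ) : ∑ A ∈ 𝓔, vpow p x (restr A v) ≤ admSup p x j v :=
  le_iSup (fun 𝓔 : {𝓔 // Adm j 𝓔} => ∑ A ∈ 𝓔.1, vpow p x (restr A v)) ⟨𝓔, h⟩

theorem vpow_le_lowerFun {p : ℝ} (hp : 1 ≤ p) (x : ℕ → X) (ρ : ℝ≥0∞) (v : ℕ →₀ ℝ) :
    vpow p x v ≤ lowerFun p x ρ v := by
  by_cases hv : v = 0
  · rw [hv, vpow_zero hp]; exact zero_le
  have h1 := (adm_singleton (Finsupp.support_nonempty_iff.2 hv)).sum_le_admSup (p := p) (x := x) v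
  rw [sum_singleton, restr_eq_self le_rfl] at h1
  refine h1.trans ?_
  have := ENNReal.le_tsum (f := fun j => ρ ^ j * admSup p x j v) 0
  simpa [lowerFun] using this

theorem admSup_smul {p : ℝ} (x : ℕ → X) (j : ℕ) (c : ℝ) (v : ℕ →₀ ℝ) :
    admSup p x j (c • v) = ENNReal.ofReal (|c| ^ p) * admSup p x j v := by
  simp only [admSup, restr_smul, vpow_smul, ENNReal.mul_iSup, mul_sum]

theorem lowerFun_smul {p : ℝ} (x : ℕ → X) (ρ : ℝ≥0∞) (c : ℝ) (v : ℕ →₀ ℝ) :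
    lowerFun p x ρ (c • v) = ENNReal.ofReal (|c| ^ p) * lowerFun p x ρ v := by
  simp only [lowerFun, admSup_smul, ← ENNReal.tsum_mul_left]
  exact tsum_congr fun j => mul_left_comm _ _ _

theorem Adm.sum_admSup_le {p : ℝ} (hp : 1 ≤ p) (x : ℕ → X) {m : ℕ} {𝓔 : Finset (Finset ℕ)}
    (h : Adm m 𝓔) (j : ℕ) (v : ℕ →₀ ℝ) :
    ∑ A ∈ 𝓔, admSup p x j (restr A v) ≤ admSup p x (j + m) v := by
  refine sum_iSup_le fun g => ?_
  set C : Finset ℕ → Finset (Finset ℕ) := fun A =>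
    ((g A).1.filter fun F => (F ∩ A).Nonempty).image (· ∩ A) with hC
  have hCmem : ∀ A G, G ∈ C A ↔ ∃ F ∈ (g A).1, (F ∩ A).Nonempty ∧ F ∩ A = G := by
    intro A G
    simp only [hC, mem_image, mem_filter, and_assoc]
  have hinner : ∀ A, ∑ F ∈ (g A).1, vpow p x (restr F (restr A v)) =
      ∑ G ∈ C A, vpow p x (restr G v) := by
    intro A
    simp only [hC]
    rw [sum_image, sum_filter_of_ne]
    · simp only [restr_restr]
    · intro F _ hne
      by_contra hemp
      rw [not_nonempty_iff_eq_empty.1 hemp, restr_eq_zero (by simp), vpow_zero hp] at hne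
      exact hne rfl
    · intro F hF F' hF' heq
      have hF := mem_filter.1 hF
      have hF' := mem_filter.1 hF'
      obtain ⟨a, ha⟩ := hF.2
      have ha' : a ∈ F' ∩ A := by
        have h1 : F ∩ A = F' ∩ A := heq
        rwa [← h1]
      exact (g A).2.eq_of_mem hF.1 hF'.1 (mem_inter.1 ha).1 (mem_inter.1 ha').1
  simp only [hinner]
  rw [← sum_biUnion]
  swap
  · intro A hA B hB hne
    refine Finset.disjoint_left.2 fun G hG hG' => hne ?_
    obtain ⟨F, -, ⟨a, ha⟩, rfl⟩ := (hCmem A G).1 hG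
    obtain ⟨F', -, -, heq⟩ := (hCmem B _).1 hG'
    rw [← heq] at ha
    have h2 : a ∈ F ∩ A := by rwa [← heq]
    exact h.eq_of_mem hA hB (mem_inter.1 h2).2 (mem_inter.1 ha).2
  refine Adm.sum_le_admSup ⟨?_, ?_, ?_⟩ v
  · intro G hG
    obtain ⟨A, -, hGA⟩ := mem_biUnion.1 hG
    obtain ⟨F, -, hne, rfl⟩ := (hCmem A G).1 hGA
    exact hne
  · intro G hG G' hG' hne
    obtain ⟨A, hA, hGA⟩ := mem_biUnion.1 hG
    obtain ⟨A', hA', hGA'⟩ := mem_biUnion.1 hG'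
    obtain ⟨F, hF, -, rfl⟩ := (hCmem A G).1 hGA
    obtain ⟨F', hF', -, rfl⟩ := (hCmem A' G').1 hGA'
    by_cases hAA : A = A'
    · subst hAA
      have hFF : F ≠ F' := by rintro rfl; exact hne rfl
      refine ((g A).2.2.1 F hF F' hF' hFF).imp ?_ ?_
      · exact fun hb a ha b hb' => hb a (mem_inter.1 ha).1 b (mem_inter.1 hb').1
      · exact fun hb a ha b hb' => hb a (mem_inter.1 ha).1 b (mem_inter.1 hb').1
    · refine (h.2.1 A hA A' hA' hAA).imp ?_ ?_
      · exact fun hb a ha b hb' => hb a (mem_inter.1 ha).2 b (mem_inter.1 hb').2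
      · exact fun hb a ha b hb' => hb a (mem_inter.1 ha).2 b (mem_inter.1 hb').2
  · rw [biUnion_image]
    refine h.biUnion_mem (C := fun A => (C A).image fmin) (fun A _ => ?_) (fun A _ => ?_)
    · refine mem_schreierNat_of_rel
        (fun d' d => ∃ F ∈ (g A).1, (F ∩ A).Nonempty ∧ fmin (F ∩ A) = d' ∧ fmin F = d)
        (g A).2.2.2 ?_ ?_
      · intro d hd
        obtain ⟨G, hG, rfl⟩ := mem_image.1 hd
        obtain ⟨F, hF, hne, rfl⟩ := (hCmem A G).1 hG
        exact ⟨fmin F, mem_image_of_mem _ hF, fmin_le (mem_inter.1 (fmin_mem hne)).1,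
          F, hF, hne, rfl, rfl⟩
      · rintro a b c d ⟨F, hF, hne, rfl, rfl⟩ ⟨F', hF', hne', rfl, rfl⟩ hlt
        have hb := (g A).2.before_of_lt hF hF' (mem_inter.1 (fmin_mem hne)).1
          (mem_inter.1 (fmin_mem hne')).1 (by rintro rfl; exact lt_irrefl _ hlt) hlt
        exact hb _ (fmin_mem ((g A).2.1 F hF)) _ (fmin_mem ((g A).2.1 F' hF'))
    · intro d hd
      obtain ⟨G, hG, rfl⟩ := mem_image.1 hd
      obtain ⟨F, hF, hne, rfl⟩ := (hCmem A G).1 hG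
      exact (mem_inter.1 (fmin_mem hne)).2

theorem Adm.mul_sum_lowerFun_le {p : ℝ} (hp : 1 ≤ p) (x : ℕ → X) (ρ : ℝ≥0∞) {m : ℕ}
    {𝓔 : Finset (Finset ℕ)} (h : Adm m 𝓔) (v : ℕ →₀ ℝ) :
    ρ ^ m * ∑ A ∈ 𝓔, lowerFun p x ρ (restr A v) ≤ lowerFun p x ρ v := by
  simp only [lowerFun]
  rw [← Summable.tsum_finsetSum fun _ _ => ENNReal.summable, ← ENNReal.tsum_mul_left]
  calc _ ≤ ∑' j, ρ ^ (j + m) * admSup p x (j + m) v := by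
        refine ENNReal.tsum_le_tsum fun j => ?_
        rw [← mul_sum, ← mul_assoc, ← pow_add, add_comm m j]
        gcongr
        exact h.sum_admSup_le hp x j v
    _ ≤ _ := ENNReal.tsum_comp_le_tsum_of_injective (add_left_injective m)
        (fun j => ρ ^ j * admSup p x j v)

end lower

theorem schreierOmega_subset {F G : Finset ℕ} (hF : F ∈ SchreierOmega) (h : G ⊆ F) :
    G ∈ SchreierOmega := by
  obtain ⟨n, hn, hle⟩ := hF
  exact ⟨n, schreierNat_subset hn h, fun a ha => hle a (h ha)⟩

/-- A sequence that is `SchreierOmega`-unconditional and `SchreierOmega`-equivalent to the basis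
of a regular mixed Tsirelson space. -/
structure OmegaTsirelson {X : Type*} [NormedAddCommGroup X] [NormedSpace ℝ X]
    (p : ℝ) (θ : ℕ → ℝ) (TZ : (ℕ →₀ ℝ) → ℝ) (x : ℕ → X) (C : ℝ) : Prop where
  one_le_p : 1 ≤ p
  regular : RegularParams θ
  isNorm : IsMixedTsirelsonNorm p Set.univ θ TZ
  ne_zero : ∀ i, x i ≠ 0
  one_le_C : 1 ≤ C
  unc : ∀ (a : ℕ →₀ ℝ), ∀ F ∈ SchreierOmega, ‖∑ i ∈ F, a i • x i‖ ≤ C * ‖vec x a‖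
  norm_le : ∀ v : ℕ →₀ ℝ, v.support ∈ SchreierOmega → ‖vec x v‖ ≤ C * TZ v
  le_norm : ∀ v : ℕ →₀ ℝ, v.support ∈ SchreierOmega → TZ v ≤ C * ‖vec x v‖

namespace OmegaTsirelson

variable {X : Type*} [NormedAddCommGroup X] [NormedSpace ℝ X]
variable {p : ℝ} {θ : ℕ → ℝ} {TZ : (ℕ →₀ ℝ) → ℝ} {x : ℕ → X} {C : ℝ}

theorem vpow_le (h : OmegaTsirelson p θ TZ x C) {v : ℕ →₀ ℝ} (hv : v.support ∈ SchreierOmega) :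
    vpow p x v ≤ ENNReal.ofReal (C ^ p) * tpow p TZ v := by
  have hC := h.one_le_C
  rw [vpow, tpow, ← ENNReal.ofReal_mul (by positivity),
    ← Real.mul_rpow (by positivity) (h.isNorm.nonneg v)]
  exact ENNReal.ofReal_le_ofReal (Real.rpow_le_rpow (norm_nonneg _) (h.norm_le v hv)
    (by linarith [h.one_le_p]))

theorem tpow_le (h : OmegaTsirelson p θ TZ x C) {v : ℕ →₀ ℝ} (hv : v.support ∈ SchreierOmega) :
    tpow p TZ v ≤ ENNReal.ofReal (C ^ p) * vpow p x v := by
  have hC := h.one_le_C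
  rw [vpow, tpow, ← ENNReal.ofReal_mul (by positivity),
    ← Real.mul_rpow (by positivity) (norm_nonneg _)]
  exact ENNReal.ofReal_le_ofReal (Real.rpow_le_rpow (h.isNorm.nonneg v) (h.le_norm v hv)
    (by linarith [h.one_le_p]))

theorem lowerFun_le (h : OmegaTsirelson p θ TZ x C) (ρ : ℝ≥0∞) {v : ℕ →₀ ℝ}
    (hv : v.support ∈ SchreierOmega) :
    lowerFun p x ρ v ≤ ENNReal.ofReal (C ^ p) ^ 2 *
      (∑' j, ρ ^ j / ENNReal.ofReal (θ j)) * vpow p x v := by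
  set D := ENNReal.ofReal (C ^ p) with hD
  have hj : ∀ j, admSup p x j v ≤ D ^ 2 * vpow p x v / ENNReal.ofReal (θ j) := by
    intro j
    refine iSup_le fun 𝓔 => ?_
    have hθ0 : ENNReal.ofReal (θ j) ≠ 0 := (ENNReal.ofReal_pos.2 (h.regular.1 j).1).ne'
    rw [ENNReal.le_div_iff_mul_le (Or.inl hθ0) (Or.inl ENNReal.ofReal_ne_top), mul_comm]
    calc ENNReal.ofReal (θ j) * ∑ A ∈ 𝓔.1, vpow p x (restr A v)
        ≤ ENNReal.ofReal (θ j) * ∑ A ∈ 𝓔.1, D * tpow p TZ (restr A v) := by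
          gcongr with A _
          refine h.vpow_le (schreierOmega_subset hv ?_)
          rw [support_restr]; exact filter_subset _ _
      _ = D * (ENNReal.ofReal (θ j) * ∑ A ∈ 𝓔.1, tpow p TZ (restr A v)) := by
          rw [← mul_sum, mul_left_comm]
      _ ≤ D * tpow p TZ v := by
          gcongr
          exact 𝓔.2.mul_sum_tpow_le h.isNorm h.one_le_p h.regular v
      _ ≤ D * (D * vpow p x v) := by
          gcongr
          exact h.tpow_le hv
      _ = _ := by ring
  calc lowerFun p x ρ v ≤ ∑' j, ρ ^ j * (D ^ 2 * vpow p x v / ENNReal.ofReal (θ j)) :=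
        ENNReal.tsum_le_tsum fun j => by gcongr; exact hj j
    _ = ∑' j, D ^ 2 * vpow p x v * (ρ ^ j / ENNReal.ofReal (θ j)) :=
        tsum_congr fun j => by simp only [div_eq_mul_inv]; ring
    _ = _ := by rw [ENNReal.tsum_mul_left]; ring

theorem vec_single (x : ℕ → X) (i : ℕ) (c : ℝ) : vec x (Finsupp.single i c) = c • x i := by
  simp [vec]

theorem vpow_ne_top (p : ℝ) (x : ℕ → X) (v : ℕ →₀ ℝ) : vpow p x v ≠ ∞ := ENNReal.ofReal_ne_top

/-- Vectors far out almost maximising the ratio `lowerFun / vpow`. -/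
theorem exists_extremal (h : OmegaTsirelson p θ TZ x C) {ρ : ℝ≥0∞}
    (hρ : ∑' j, ρ ^ j / ENNReal.ofReal (θ j) < ∞) :
    ∃ (M : ℕ) (r : ℝ≥0∞), r ≠ 0 ∧ r ≠ ∞ ∧
      (∀ q, ∃ v : ℕ →₀ ℝ, v.support ∈ SchreierNat M ∧ (∀ i ∈ v.support, q ≤ i) ∧
        ‖vec x v‖ = 1 ∧ r ≤ lowerFun p x ρ v) ∧
      ∀ M', ∃ q, ∀ v : ℕ →₀ ℝ, v.support ∈ SchreierNat M' → (∀ i ∈ v.support, q ≤ i) →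
        lowerFun p x ρ v ≤ 2 * r * vpow p x v := by
  have hp0 : 0 < p := by linarith [h.one_le_p]
  set K := ENNReal.ofReal (C ^ p) ^ 2 * (∑' j, ρ ^ j / ENNReal.ofReal (θ j)) with hK
  have hKt : K < ∞ := ENNReal.mul_lt_top (by finiteness) hρ
  set R : Set ℝ≥0∞ := {r | ∃ M, ∀ q, ∃ v : ℕ →₀ ℝ, v.support ∈ SchreierNat M ∧
    (∀ i ∈ v.support, q ≤ i) ∧ vpow p x v ≠ 0 ∧ r * vpow p x v ≤ lowerFun p x ρ v} with hR
  have hone : (1 : ℝ≥0∞) ∈ R := by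
    refine ⟨0, fun q => ⟨Finsupp.single q 1, ?_, ?_, ?_, ?_⟩⟩
    · rw [Finsupp.support_single q one_ne_zero]
      exact singleton_mem_schreierNat_zero _
    · intro i hi
      rw [Finsupp.support_single q one_ne_zero, mem_singleton] at hi
      exact hi.ge
    · rw [vpow, vec_single, one_smul]
      exact (ENNReal.ofReal_pos.2 (Real.rpow_pos_of_pos (norm_pos_iff.2 (h.ne_zero q)) _)).ne'
    · rw [one_mul]
      exact vpow_le_lowerFun h.one_le_p x ρ _
  have hle : ∀ r ∈ R, r ≤ K := by
    rintro r ⟨M, hM⟩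
    obtain ⟨v, hv, hvM, hne, hr⟩ := hM M
    have h1 := hr.trans (h.lowerFun_le ρ ⟨M, hv, hvM⟩)
    exact (ENNReal.mul_le_mul_iff_left hne (vpow_ne_top p x v)).1 h1
  have hsup1 : 1 ≤ sSup R := le_sSup hone
  have hsupt : sSup R ≠ ∞ := ((sSup_le hle).trans_lt hKt).ne
  have hlt : sSup R / 2 < sSup R :=
    ENNReal.half_lt_self (zero_lt_one.trans_le hsup1).ne' hsupt
  obtain ⟨r, hrR, hr⟩ := lt_sSup_iff.1 hlt
  have hr0 : r ≠ 0 := (zero_le.trans_lt hr).ne'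
  have hrt : r ≠ ∞ := ((hle r hrR).trans_lt hKt).ne
  have hr2 : sSup R < 2 * r := by
    rw [ENNReal.div_lt_iff (Or.inl two_ne_zero) (Or.inl ENNReal.ofNat_ne_top)] at hr
    rwa [mul_comm]
  obtain ⟨M, hM⟩ := hrR
  refine ⟨M, r, hr0, hrt, fun q => ?_, fun M' => ?_⟩
  · obtain ⟨v, hv, hvq, hne, hle'⟩ := hM q
    have hn : ‖vec x v‖ ≠ 0 := by
      intro h0
      rw [vpow, h0, Real.zero_rpow hp0.ne', ENNReal.ofReal_zero] at hne
      exact hne rfl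
    refine ⟨‖vec x v‖⁻¹ • v, ?_, ?_, ?_, ?_⟩
    · exact schreierNat_subset hv Finsupp.support_smul
    · exact fun i hi => hvq i (Finsupp.support_smul hi)
    · rw [vec_smul, norm_smul, norm_inv, norm_norm, inv_mul_cancel₀ hn]
    · have h1 : ENNReal.ofReal (|‖vec x v‖⁻¹| ^ p) * vpow p x v = 1 := by
        rw [← vpow_smul, vpow, vec_smul, norm_smul, norm_inv, norm_norm, inv_mul_cancel₀ hn,
          Real.one_rpow, ENNReal.ofReal_one]
      calc r = ENNReal.ofReal (|‖vec x v‖⁻¹| ^ p) * (r * vpow p x v) := by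
            rw [mul_left_comm, h1, mul_one]
        _ ≤ _ := by
            rw [lowerFun_smul]
            gcongr
  · by_contra! hcon
    have hmem : 2 * r ∈ R := by
      refine ⟨M', fun q => ?_⟩
      obtain ⟨v, hv, hvq, hlt'⟩ := hcon (max q M')
      refine ⟨v, hv, fun i hi => (le_max_left _ _).trans (hvq i hi), ?_, hlt'.le⟩
      intro h0
      have h1 := h.lowerFun_le ρ (v := v) ⟨M', hv, fun i hi => (le_max_right _ _).trans (hvq i hi)⟩
      rw [h0, mul_zero] at h1
      exact absurd (zero_le.trans_lt hlt') (not_lt.2 h1)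
    exact absurd (le_sSup hmem) hr2.not_ge

end OmegaTsirelson

/-- Successive nonempty blocks, supported by members of `SchreierNat M`, with `u i` beyond `i`. -/
structure BlockSeq (M : ℕ) (u : ℕ → ℕ →₀ ℝ) : Prop where
  nonempty : ∀ i, (u i).support.Nonempty
  mem : ∀ i, (u i).support ∈ SchreierNat M
  le : ∀ i, ∀ a ∈ (u i).support, i ≤ a
  before : ∀ i j, i < j → Before (u i).support (u j).support

/-- The linear combination of blocks. -/
noncomputable def comb (u : ℕ → ℕ →₀ ℝ) (b : ℕ →₀ ℝ) : ℕ →₀ ℝ := Finsupp.linearCombination ℝ u b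

theorem comb_apply (u : ℕ → ℕ →₀ ℝ) {b : ℕ →₀ ℝ} {s : Finset ℕ} (hs : b.support ⊆ s) (j : ℕ) :
    comb u b j = ∑ i ∈ s, b i * u i j := by
  rw [comb, Finsupp.linearCombination_apply, Finsupp.sum_of_support_subset _ hs _ (by simp)]
  simp [Finsupp.finsetSum_apply]

theorem vec_comb {X : Type*} [NormedAddCommGroup X] [NormedSpace ℝ X] (x : ℕ → X)
    (u : ℕ → ℕ →₀ ℝ) (b : ℕ →₀ ℝ) : vec x (comb u b) = vec (fun i => vec x (u i)) b := by
  rw [vec_eq, comb, Finsupp.linearCombination_linearCombination]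
  rfl

theorem support_comb_subset (u : ℕ → ℕ →₀ ℝ) (b : ℕ →₀ ℝ) :
    (comb u b).support ⊆ b.support.biUnion fun i => (u i).support := by
  intro j hj
  rw [Finsupp.mem_support_iff, comb_apply u le_rfl] at hj
  obtain ⟨i, hi, hne⟩ := exists_ne_zero_of_sum_ne_zero hj
  exact mem_biUnion.2 ⟨i, hi, Finsupp.mem_support_iff.2 (right_ne_zero_of_mul hne)⟩

namespace BlockSeq

variable {M : ℕ} {u : ℕ → ℕ →₀ ℝ}

theorem eq_of_mem (h : BlockSeq M u) {i j a : ℕ} (hi : a ∈ (u i).support)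
    (hj : a ∈ (u j).support) : i = j := by
  by_contra hne
  rcases lt_or_gt_of_ne hne with hlt | hlt
  · exact lt_irrefl _ (h.before i j hlt a hi a hj)
  · exact lt_irrefl _ (h.before j i hlt a hj a hi)

theorem comb_restr (h : BlockSeq M u) (A : Finset ℕ) (b : ℕ →₀ ℝ) :
    comb u (restr A b) = restr (A.biUnion fun i => (u i).support) (comb u b) := by
  have hsub : (restr A b).support ⊆ b.support := by
    rw [support_restr]; exact filter_subset _ _
  ext j
  rw [comb_apply u hsub, restr_apply, comb_apply u (le_refl b.support)]
  split_ifs with hj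
  · obtain ⟨i₀, hi₀, hj₀⟩ := mem_biUnion.1 hj
    refine sum_congr rfl fun i _ => ?_
    rw [restr_apply]
    split_ifs with hi
    · rfl
    · have : u i j = 0 := by
        by_contra hne
        exact hi (h.eq_of_mem hj₀ (Finsupp.mem_support_iff.2 hne) ▸ hi₀)
      simp [this]
  · refine sum_eq_zero fun i _ => ?_
    rw [restr_apply]
    split_ifs with hi
    · have : u i j = 0 := by
        by_contra hne
        exact hj (mem_biUnion.2 ⟨i, hi, Finsupp.mem_support_iff.2 hne⟩)
      simp [this]
    · simp

theorem support_comb_mem (h : BlockSeq M u) {n : ℕ} {b : ℕ →₀ ℝ}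
    (hb : b.support ∈ SchreierNat n) : (comb u b).support ∈ SchreierNat (M + n) :=
  schreierNat_subset (biUnion_mem_schreierNat hb (fun i _ => h.mem i) (fun i _ => h.le i)
    fun i _ j _ hij => h.before i j hij) (support_comb_subset u b)

theorem le_of_mem_support_comb (h : BlockSeq M u) {q : ℕ} {b : ℕ →₀ ℝ}
    (hb : ∀ i ∈ b.support, q ≤ i) : ∀ a ∈ (comb u b).support, q ≤ a := by
  intro a ha
  obtain ⟨i, hi, hai⟩ := mem_biUnion.1 (support_comb_subset u b ha)
  exact (hb i hi).trans (h.le i a hai)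

theorem biUnion_nonempty (h : BlockSeq M u) {A : Finset ℕ} (hA : A.Nonempty) :
    (A.biUnion fun i => (u i).support).Nonempty := by
  obtain ⟨a, ha⟩ := hA
  obtain ⟨b, hb⟩ := h.nonempty a
  exact ⟨b, mem_biUnion.2 ⟨a, ha, hb⟩⟩

theorem biUnion_before (h : BlockSeq M u) {A B : Finset ℕ} (hAB : Before A B) :
    Before (A.biUnion fun i => (u i).support) (B.biUnion fun i => (u i).support) := by
  intro a ha b hb
  obtain ⟨i, hi, hai⟩ := mem_biUnion.1 ha
  obtain ⟨j, hj, hbj⟩ := mem_biUnion.1 hb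
  exact h.before i j (hAB i hi j hj) a hai b hbj

theorem biUnion_inj (h : BlockSeq M u) {m : ℕ} {𝓔 : Finset (Finset ℕ)} (hA : Adm m 𝓔)
    {A B : Finset ℕ} (hAm : A ∈ 𝓔) (hBm : B ∈ 𝓔) {a : ℕ}
    (haA : a ∈ A.biUnion fun i => (u i).support) (haB : a ∈ B.biUnion fun i => (u i).support) :
    A = B := by
  obtain ⟨i, hi, hai⟩ := mem_biUnion.1 haA
  obtain ⟨j, hj, haj⟩ := mem_biUnion.1 haB
  exact hA.eq_of_mem hAm hBm hi (h.eq_of_mem hai haj ▸ hj)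

theorem adm (h : BlockSeq M u) {m : ℕ} {𝓔 : Finset (Finset ℕ)} (hA : Adm m 𝓔) :
    Adm m (𝓔.image fun A => A.biUnion fun i => (u i).support) := by
  refine ⟨?_, ?_, ?_⟩
  · intro A hA'
    obtain ⟨A, hAm, rfl⟩ := mem_image.1 hA'
    exact h.biUnion_nonempty (hA.1 A hAm)
  · intro A hA' B hB' hne
    obtain ⟨A, hAm, rfl⟩ := mem_image.1 hA'
    obtain ⟨B, hBm, rfl⟩ := mem_image.1 hB'
    exact (hA.2.1 A hAm B hBm (by rintro rfl; exact hne rfl)).imp h.biUnion_before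
      h.biUnion_before
  · refine mem_schreierNat_of_rel (fun d' d => ∃ A ∈ 𝓔,
      fmin (A.biUnion fun i => (u i).support) = d' ∧ fmin A = d) hA.2.2 ?_ ?_
    · intro d hd
      rw [image_image] at hd
      obtain ⟨A, hAm, rfl⟩ := mem_image.1 hd
      refine ⟨fmin A, mem_image_of_mem _ hAm, ?_, A, hAm, rfl, rfl⟩
      obtain ⟨i, hi, hai⟩ := mem_biUnion.1 (fmin_mem (h.biUnion_nonempty (hA.1 A hAm)))
      exact (fmin_le hi).trans (h.le i _ hai)
    · rintro a b c d ⟨A, hAm, rfl, rfl⟩ ⟨B, hBm, rfl, rfl⟩ hlt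
      have hne : A ≠ B := by rintro rfl; exact lt_irrefl _ hlt
      rcases hA.2.1 A hAm B hBm hne with hb | hb
      · exact hb _ (fmin_mem (hA.1 A hAm)) _ (fmin_mem (hA.1 B hBm))
      · have := h.biUnion_before hb _ (fmin_mem (h.biUnion_nonempty (hA.1 B hBm))) _
          (fmin_mem (h.biUnion_nonempty (hA.1 A hAm)))
        exact absurd hlt this.not_gt

section
variable {X : Type*} [NormedAddCommGroup X] [NormedSpace ℝ X] {p : ℝ} {x : ℕ → X} {ρ r : ℝ≥0∞}

theorem mul_sum_comb_le (h : BlockSeq M u) (hp : 1 ≤ p) {m : ℕ} {𝓔 : Finset (Finset ℕ)}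
    (hA : Adm m 𝓔) (b : ℕ →₀ ℝ) :
    ρ ^ m * ∑ A ∈ 𝓔, lowerFun p x ρ (comb u (restr A b)) ≤ lowerFun p x ρ (comb u b) := by
  refine le_trans (le_of_eq ?_) ((h.adm hA).mul_sum_lowerFun_le hp x ρ (comb u b))
  rw [sum_image]
  · simp only [h.comb_restr]
  · intro A hAm B hBm heq
    obtain ⟨a, ha⟩ := h.biUnion_nonempty (hA.1 A hAm)
    have heq' : (A.biUnion fun i => (u i).support) = B.biUnion fun i => (u i).support := heq
    exact h.biUnion_inj hA hAm hBm ha (heq' ▸ ha)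

theorem mass_mul_le (h : BlockSeq M u) (hp : 1 ≤ p) (hr : ∀ i, r ≤ lowerFun p x ρ (u i))
    (b : ℕ →₀ ℝ) (i : ℕ) : mass p b i * r ≤ lowerFun p x ρ (comb u b) := by
  have h1 := h.mul_sum_comb_le (ρ := ρ) (x := x) hp (adm_singleton (singleton_nonempty i)) b
  have h2 : comb u (restr {i} b) = b i • u i := by
    ext j
    rw [comb_apply u (s := {i}), sum_singleton, restr_apply, if_pos (mem_singleton_self i)]
    · rfl
    · rw [support_restr]
      exact fun j hj => (mem_filter.1 hj).2
  rw [pow_zero, one_mul, sum_singleton, h2, lowerFun_smul] at h1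
  refine le_trans ?_ h1
  rw [mass]
  gcongr
  exact hr i

theorem lmass_mul_le (h : BlockSeq M u) (hp : 1 ≤ p) (hr : ∀ i, r ≤ lowerFun p x ρ (u i))
    {m : ℕ} {b : ℕ →₀ ℝ} (hb : b.support ∈ SchreierNat m) :
    ρ ^ m * (lmass p b * r) ≤ lowerFun p x ρ (comb u b) := by
  have hA : Adm m (b.support.image fun i => {i}) := by
    refine ⟨?_, ?_, ?_⟩
    · intro A hA
      obtain ⟨i, -, rfl⟩ := mem_image.1 hA
      exact singleton_nonempty i
    · intro A hA B hB hne
      obtain ⟨i, -, rfl⟩ := mem_image.1 hA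
      obtain ⟨j, -, rfl⟩ := mem_image.1 hB
      simp only [Before, mem_singleton, forall_eq]
      exact lt_or_gt_of_ne fun hij => hne (by rw [hij])
    · rw [image_image]
      refine schreierNat_subset hb fun d hd => ?_
      obtain ⟨i, hi, rfl⟩ := mem_image.1 hd
      have := mem_singleton.1 (fmin_mem (singleton_nonempty i))
      simpa [this] using hi
  refine le_trans ?_ (h.mul_sum_comb_le hp hA b)
  rw [sum_image fun i _ j _ hij => singleton_injective hij, lmass, sum_mul]
  gcongr with i hi
  have := h.mass_mul_le (ρ := ρ) (x := x) hp hr (restr {i} b) i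
  rwa [mass_restr hp, if_pos (mem_singleton_self i)] at this

end

end BlockSeq

namespace OmegaTsirelson

variable {X : Type*} [NormedAddCommGroup X] [NormedSpace ℝ X]
variable {p : ℝ} {θ : ℕ → ℝ} {TZ : (ℕ →₀ ℝ) → ℝ} {x : ℕ → X} {C : ℝ}

/-- A class of normalized blocks whose sequences dominate the Tsirelson basis. -/
theorem exists_block_class (h : OmegaTsirelson p θ TZ x C) {ρ : ℝ≥0∞}
    (hρ : ∑' j, ρ ^ j / ENNReal.ofReal (θ j) < ∞) :
    ∃ (M : ℕ) (P : (ℕ →₀ ℝ) → Prop),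
      (∀ q, ∃ v : ℕ →₀ ℝ, P v ∧ v.support ∈ SchreierNat M ∧ (∀ i ∈ v.support, q ≤ i) ∧
        ‖vec x v‖ = 1) ∧
      ∀ u, BlockSeq M u → (∀ i, P (u i)) →
        (∀ m, ∃ q, ∀ b : ℕ →₀ ℝ, b.support ∈ SchreierNat m → (∀ i ∈ b.support, q ≤ i) →
          ρ ^ m * lmass p b ≤ 2 * vpow p x (comb u b)) ∧
        ∀ (n n' : ℕ) (K : ℝ≥0∞), n < n' →
          (∀ l, n < l → l ≤ n' → ENNReal.ofReal (θ l) ≤ K * ρ ^ l) →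
          ∃ q, ∀ b : ℕ →₀ ℝ, b.support ∈ SchreierNat n' → (∀ i ∈ b.support, q ≤ i) →
            tpow p TZ b ≤ gmass p n b + 4 * K * vpow p x (comb u b) := by
  have hp := h.one_le_p
  obtain ⟨M, r, hr0, hrt, hex, hub⟩ := h.exists_extremal hρ
  refine ⟨M, fun v => r ≤ lowerFun p x ρ v, fun q => ?_, fun u hu hr => ?_⟩
  · obtain ⟨v, h1, h2, h3, h4⟩ := hex q
    exact ⟨v, h4, h1, h2, h3⟩
  have hub' : ∀ m, ∃ q, ∀ b : ℕ →₀ ℝ, b.support ∈ SchreierNat m → (∀ i ∈ b.support, q ≤ i) →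
      lowerFun p x ρ (comb u b) / r ≤ 2 * vpow p x (comb u b) := by
    intro m
    obtain ⟨q, hq⟩ := hub (M + m)
    refine ⟨q, fun b hb hbq => ?_⟩
    refine ENNReal.div_le_of_le_mul ?_
    rw [mul_right_comm]
    exact hq _ (hu.support_comb_mem hb) (hu.le_of_mem_support_comb hbq)
  have hl : ∀ m (b : ℕ →₀ ℝ), b.support ∈ SchreierNat m →
      ρ ^ m * lmass p b ≤ lowerFun p x ρ (comb u b) / r := by
    intro m b hb
    rw [ENNReal.le_div_iff_mul_le (Or.inl hr0) (Or.inl hrt), mul_assoc]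
    exact hu.lmass_mul_le hp hr hb
  refine ⟨fun m => ?_, fun n n' K hn hK => ?_⟩
  · obtain ⟨q, hq⟩ := hub' m
    exact ⟨q, fun b hb hbq => (hl m b hb).trans (hq b hb hbq)⟩
  · obtain ⟨q, hq⟩ := hub' n'
    refine ⟨max q 1, fun b hb hbq => ?_⟩
    have hb1 : ∀ i ∈ b.support, 1 ≤ i := fun i hi => (le_max_right _ _).trans (hbq i hi)
    have hbq' := hq b hb fun i hi => (le_max_left _ _).trans (hbq i hi)
    have h1 := tpow_le_gmass_add h.isNorm hp h.regular (n := n) (n' := n') (ρ := ρ) (K := K)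
      (N := fun b => lowerFun p x ρ (comb u b) / r) ?_ ?_ hK b hb1
    · refine h1.trans ?_
      rw [add_assoc]
      gcongr
      have h2 : ENNReal.ofReal (θ n') * lmass p b ≤ K * (2 * vpow p x (comb u b)) := by
        calc _ ≤ K * ρ ^ n' * lmass p b := by gcongr; exact hK n' hn le_rfl
          _ = K * (ρ ^ n' * lmass p b) := mul_assoc _ _ _
          _ ≤ _ := mul_le_mul_right ((hl n' b hb).trans hbq') _
      calc _ ≤ K * (2 * vpow p x (comb u b)) + K * (2 * vpow p x (comb u b)) := by gcongr
        _ = _ := by ring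
    · intro b i _
      rw [ENNReal.le_div_iff_mul_le (Or.inl hr0) (Or.inl hrt)]
      exact hu.mass_mul_le hp hr b i
    · intro m 𝓔 b _ hA
      rw [ENNReal.le_div_iff_mul_le (Or.inl hr0) (Or.inl hrt)]
      simp only [div_eq_mul_inv]
      rw [← sum_mul, mul_assoc, mul_assoc, ENNReal.inv_mul_cancel hr0 hrt, mul_one]
      exact hu.mul_sum_comb_le hp hA b

end OmegaTsirelson

theorem exists_lt_pow_ge {t : ℝ} (ht : 0 < t) (n : ℕ) :
    ∃ ρ, 0 < ρ ∧ ρ < t ∧ ∀ l ≤ n, t ^ l / 2 ≤ ρ ^ l := by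
  have hn : (0 : ℝ) < 2 * (n + 1) := by positivity
  have hd : 1 / (2 * ((n : ℝ) + 1)) ≤ 1 / 2 := by
    apply one_div_le_one_div_of_le (by norm_num)
    have : (0 : ℝ) ≤ n := Nat.cast_nonneg n
    linarith
  have hd0 : 0 < 1 / (2 * ((n : ℝ) + 1)) := by positivity
  set s : ℝ := 1 - 1 / (2 * ((n : ℝ) + 1)) with hs
  have hs0 : 0 < s := by linarith
  have hs1 : s < 1 := by linarith
  have hsn : 1 / 2 ≤ s ^ n := by
    have h1 := one_add_mul_le_pow (a := -(1 / (2 * ((n : ℝ) + 1)))) (by linarith) n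
    have h2 : (n : ℝ) * (1 / (2 * ((n : ℝ) + 1))) ≤ 1 / 2 := by
      rw [mul_one_div, div_le_div_iff₀ hn two_pos]
      linarith
    have h3 : 1 + -(1 / (2 * ((n : ℝ) + 1))) = s := by rw [hs]; ring
    rw [h3] at h1
    linarith
  refine ⟨t * s, by positivity, by nlinarith, fun l hl => ?_⟩
  have h1 : s ^ n ≤ s ^ l := pow_le_pow_of_le_one hs0.le hs1.le hl
  rw [mul_pow]
  have h2 : 0 < t ^ l := by positivity
  nlinarith

theorem lmass_restr {p : ℝ} (hp : 1 ≤ p) (F : Finset ℕ) (a : ℕ →₀ ℝ) :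
    lmass p (restr F a) = ENNReal.ofReal (∑ i ∈ F, |a i| ^ p) := by
  rw [ENNReal.ofReal_sum_of_nonneg fun _ _ => Real.rpow_nonneg (abs_nonneg _) _, lmass,
    support_restr]
  rw [sum_subset (s₁ := a.support.filter (· ∈ F)) (s₂ := F) fun i hi => (mem_filter.1 hi).2]
  · refine sum_congr rfl fun i hi => ?_
    rw [mass_restr hp, if_pos hi, mass]
  · intro i hi hni
    have : a i = 0 := by
      by_contra hne
      exact hni (mem_filter.2 ⟨Finsupp.mem_support_iff.2 hne, hi⟩)
    rw [mass_restr hp, if_pos hi, mass, this, abs_zero, Real.zero_rpow (by linarith),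
      ENNReal.ofReal_zero]

theorem gmass_restr_le {p : ℝ} (hp : 1 ≤ p) {n : ℕ} {F : Finset ℕ} {a : ℕ →₀ ℝ} {η : ℝ}
    (h : ∀ G ⊆ F, G ∈ SchreierNat n → ∑ i ∈ G, |a i| ^ p ≤ η) :
    gmass p n (restr F a) ≤ ENNReal.ofReal η := by
  refine iSup_le fun G => ?_
  simp only [mass_restr hp]
  rw [sum_ite_mem]
  simp only [mass]
  rw [← ENNReal.ofReal_sum_of_nonneg fun _ _ => Real.rpow_nonneg (abs_nonneg _) _]
  exact ENNReal.ofReal_le_ofReal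
    (h _ inter_subset_right (schreierNat_subset G.2 inter_subset_left))

/-- A doubly indexed family of successive blocks can be chosen from prescribed classes. -/
theorem exists_block_family {P : ℕ → (ℕ →₀ ℝ) → Prop}
    (hP : ∀ k q, ∃ v, P k v ∧ v ≠ 0 ∧ ∀ i ∈ v.support, q ≤ i) :
    ∃ w : ℕ → ℕ →₀ ℝ, (∀ j, P j.unpair.1 (w j)) ∧ (∀ j, w j ≠ 0) ∧
      (∀ j, ∀ a ∈ (w j).support, j ≤ a) ∧
      ∀ i j, i < j → Before (w i).support (w j).support := by
  choose v hv hv0 hvq using hP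
  set q : ℕ → ℕ := fun j => Nat.rec 0
    (fun j q => q + (v j.unpair.1 q).support.sup id + 1) j with hq
  have hqs : ∀ j, q (j + 1) = q j + (v j.unpair.1 (q j)).support.sup id + 1 := fun j => rfl
  have hmono : StrictMono q := strictMono_nat_of_lt_succ fun j => by rw [hqs]; omega
  refine ⟨fun j => v j.unpair.1 (q j), fun j => hv _ _, fun j => hv0 _ _, fun j a ha => ?_, ?_⟩
  · exact (hmono.id_le j).trans (hvq _ _ a ha)
  · intro i j hij a ha b hb
    have h1 : a ≤ (v i.unpair.1 (q i)).support.sup id := Finset.le_sup (f := id) ha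
    have h2 := hvq _ _ b hb
    have h3 : q (i + 1) ≤ q j := hmono.monotone hij
    rw [hqs] at h3
    omega

/-- The coefficients of the weighted sums of the blocks `w (Nat.pair k i)`, `k ≤ i`. -/
noncomputable def mixedBlock (w : ℕ → ℕ →₀ ℝ) (i : ℕ) : ℕ →₀ ℝ :=
  ∑ k ∈ range (i + 1), (1 / 2 : ℝ) ^ k • w (Nat.pair k i)

theorem restr_comb_mixedBlock {w : ℕ → ℕ →₀ ℝ}
    (hw : ∀ i j, i < j → Before (w i).support (w j).support) {k : ℕ} {F : Finset ℕ}
    (hF : ∀ i ∈ F, k ≤ i) (a : ℕ →₀ ℝ) :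
    restr (F.biUnion fun i => (w (Nat.pair k i)).support) (comb (mixedBlock w) a) =
      (1 / 2 : ℝ) ^ k • comb (fun i => w (Nat.pair k i)) (restr F a) := by
  have hinj : ∀ {i j l : ℕ}, w i l ≠ 0 → w j l ≠ 0 → i = j := by
    intro i j l hi hj
    by_contra hne
    have hi := Finsupp.mem_support_iff.2 hi
    have hj := Finsupp.mem_support_iff.2 hj
    rcases lt_or_gt_of_ne hne with hlt | hlt
    · exact lt_irrefl _ (hw i j hlt l hi l hj)
    · exact lt_irrefl _ (hw j i hlt l hj l hi)
  have hsub : (restr F a).support ⊆ F := by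
    rw [support_restr]
    exact fun i hi => (mem_filter.1 hi).2
  ext j
  rw [restr_apply, Finsupp.smul_apply, comb_apply _ hsub]
  split_ifs with hj
  · obtain ⟨i₀, hi₀, hj₀⟩ := mem_biUnion.1 hj
    have hj₀ := Finsupp.mem_support_iff.1 hj₀
    have hmix : ∀ i, mixedBlock w i j =
        if i = i₀ then (1 / 2 : ℝ) ^ k * w (Nat.pair k i₀) j else 0 := by
      intro i
      simp only [mixedBlock, Finsupp.finsetSum_apply, Finsupp.smul_apply, smul_eq_mul]
      split_ifs with hi
      · subst hi
        rw [sum_eq_single k]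
        · intro k' _ hne
          by_contra h0
          have := hinj (right_ne_zero_of_mul h0) hj₀
          rw [Nat.pair_eq_pair] at this
          exact hne this.1
        · intro hk
          exact absurd (mem_range.2 (Nat.lt_succ_of_le (hF i hi₀))) hk
      · refine sum_eq_zero fun k' _ => ?_
        by_contra h0
        have := hinj (right_ne_zero_of_mul h0) hj₀
        rw [Nat.pair_eq_pair] at this
        exact hi this.2
    rw [comb_apply _ (subset_union_left (s₂ := F)), sum_eq_single i₀, sum_eq_single i₀, hmix,
      if_pos rfl, restr_apply, if_pos hi₀, smul_eq_mul]
    · ring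
    · intro i _ hne
      by_contra h0
      have := hinj (right_ne_zero_of_mul h0) hj₀
      rw [Nat.pair_eq_pair] at this
      exact hne this.2
    · intro hn; exact absurd hi₀ hn
    · intro i _ hne
      rw [hmix, if_neg hne, mul_zero]
    · intro hn; exact absurd (mem_union_right _ hi₀) hn
  · rw [sum_eq_zero, smul_zero]
    intro i hi
    have : w (Nat.pair k i) j = 0 := by
      by_contra hne
      exact hj (mem_biUnion.2 ⟨i, hi, Finsupp.mem_support_iff.2 hne⟩)
    rw [this, mul_zero]

namespace OmegaTsirelson

variable {X : Type*} [NormedAddCommGroup X] [NormedSpace ℝ X]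
variable {p : ℝ} {θ : ℕ → ℝ} {TZ : (ℕ →₀ ℝ) → ℝ} {x : ℕ → X} {C : ℝ}

theorem norm_comb_le (h : OmegaTsirelson p θ TZ x C) {w : ℕ → ℕ →₀ ℝ}
    (hw : ∀ i j, i < j → Before (w i).support (w j).support) {k M m : ℕ}
    (hu : BlockSeq M fun i => w (Nat.pair k i)) {F : Finset ℕ} (hF : F ∈ SchreierNat m)
    (hk : ∀ i ∈ F, k ≤ i) (hM : ∀ i ∈ F, M + m ≤ i) (a : ℕ →₀ ℝ) :
    ‖vec x (comb (fun i => w (Nat.pair k i)) (restr F a))‖ ≤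
      2 ^ k * C * ‖vec (fun i => vec x (mixedBlock w i)) a‖ := by
  have hmem : (F.biUnion fun i => (w (Nat.pair k i)).support) ∈ SchreierOmega := by
    refine ⟨M + m, biUnion_mem_schreierNat hF (fun i _ => hu.mem i) (fun i _ => hu.le i)
      fun i _ j _ hij => hu.before i j hij, fun b hb => ?_⟩
    obtain ⟨i, hi, hbi⟩ := mem_biUnion.1 hb
    exact (hM i hi).trans (hu.le i b hbi)
  have h1 := h.unc (comb (mixedBlock w) a) _ hmem
  rw [← vec_restr, restr_comb_mixedBlock hw hk, vec_smul, norm_smul, vec_comb x (mixedBlock w),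
    Real.norm_of_nonneg (by positivity)] at h1
  have h2 : (2 : ℝ) ^ k * (1 / 2 : ℝ) ^ k = 1 := by rw [← mul_pow]; norm_num
  calc _ = 2 ^ k * ((1 / 2 : ℝ) ^ k *
        ‖vec x (comb (fun i => w (Nat.pair k i)) (restr F a))‖) := by
        rw [← mul_assoc, h2, one_mul]
    _ ≤ 2 ^ k * (C * ‖vec (fun i => vec x (mixedBlock w i)) a‖) := by gcongr
    _ = _ := by ring

/-- A bounded sequence whose members dominate the basis in a controlled way along the Schreier
families. -/
theorem exists_dominating (h : OmegaTsirelson p θ TZ x C) {t : ℝ}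
    (hlim : Tendsto (fun n : ℕ => θ n ^ (1 / (n : ℝ))) atTop (nhds t))
    (hratio : Tendsto (fun n : ℕ => θ n / t ^ n) atTop (nhds 0)) :
    ∃ (y : ℕ → X) (n q : ℕ → ℕ) (D : ℕ → ℝ) (r : ℕ → ℕ), (∀ i, ‖y i‖ ≤ 2) ∧
      (∀ m, 0 < D m) ∧
      (∀ m, ∀ F ∈ SchreierNat m, (∀ i ∈ F, q m ≤ i) → ∀ a : ℕ →₀ ℝ,
        ∑ i ∈ F, |a i| ^ p ≤ D m * ‖vec y a‖ ^ p) ∧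
      ∀ k, ∀ F ∈ SchreierNat (n (k + 1) + 1), (∀ i ∈ F, r k ≤ i) → ∀ a : ℕ →₀ ℝ,
        ‖vec y a‖ ≤ 1 →
        (∀ G ⊆ F, G ∈ SchreierNat (n k) → ∑ i ∈ G, |a i| ^ p ≤ ((1 / 4 : ℝ) ^ k) ^ p) →
        ‖∑ i ∈ F, a i • x i‖ ≤ 2 * C * (1 / 4 : ℝ) ^ k := by
  have hp := h.one_le_p
  have hp0 : 0 < p := by linarith
  have hC := h.one_le_C
  have hC0 : 0 < C := by linarith
  have ht := h.regular.limit_pos hlim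
  set K : ℕ → ℝ := fun k => ((1 / 4 : ℝ) ^ k) ^ p / (4 * (2 ^ k * C) ^ p) with hK
  have hK0 : ∀ k, 0 < K k := fun k => by positivity
  obtain ⟨n, hn, hnθ⟩ : ∃ n : ℕ → ℕ, StrictMono n ∧
      ∀ k, ∀ l ≥ n k, θ l ≤ K k / 2 * t ^ l := by
    refine extraction_forall_of_eventually
      (P := fun k m => ∀ l ≥ m, θ l ≤ K k / 2 * t ^ l) fun k => ?_
    refine eventually_forall_ge_atTop.2 ?_
    filter_upwards [hratio.eventually_lt_const (half_pos (hK0 k))] with l hl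
    exact ((div_lt_iff₀ (by positivity)).1 hl).le
  choose ρ hρ0 hρt hρ using fun k => exists_lt_pow_ge ht (n (k + 1) + 1)
  have hKρ : ∀ k l, n k < l → l ≤ n (k + 1) + 1 →
      ENNReal.ofReal (θ l) ≤ ENNReal.ofReal (K k) * ENNReal.ofReal (ρ k) ^ l := by
    intro k l hl hl'
    rw [← ENNReal.ofReal_pow (hρ0 k).le, ← ENNReal.ofReal_mul (hK0 k).le]
    refine ENNReal.ofReal_le_ofReal ((hnθ k l hl.le).trans ?_)
    have := mul_le_mul_of_nonneg_left (hρ k l hl') (hK0 k).le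
    linarith
  choose M P hP hblock using fun k =>
    h.exists_block_class (h.regular.tsum_lt_top hlim (hρ0 k) (hρt k))
  obtain ⟨w, hwP, hw0, hwle, hwb⟩ := exists_block_family
    (P := fun k v => P k v ∧ v.support ∈ SchreierNat (M k) ∧ ‖vec x v‖ = 1) fun k q => by
      obtain ⟨v, h1, h2, h3, h4⟩ := hP k q
      refine ⟨v, ⟨h1, h2, h4⟩, ?_, h3⟩
      rintro rfl
      simp [vec] at h4
  have hwP' : ∀ k i, P k (w (Nat.pair k i)) ∧ (w (Nat.pair k i)).support ∈ SchreierNat (M k) ∧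
      ‖vec x (w (Nat.pair k i))‖ = 1 := by
    intro k i
    simpa using hwP (Nat.pair k i)
  have hu : ∀ k, BlockSeq (M k) fun i => w (Nat.pair k i) := fun k =>
    ⟨fun i => Finsupp.support_nonempty_iff.2 (hw0 _), fun i => (hwP' k i).2.1,
      fun i a ha => (Nat.right_le_pair k i).trans (hwle _ a ha),
      fun i j hij => hwb _ _ (Nat.pair_lt_pair_right k hij)⟩
  have hmain := fun k => hblock k _ (hu k) fun i => (hwP' k i).1
  choose q hq using (hmain 0).1
  choose r hr using fun k => (hmain k).2 (n k) (n (k + 1) + 1) (ENNReal.ofReal (K k))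
    ((hn (Nat.lt_succ_self k)).trans (Nat.lt_succ_self _)) (hKρ k)
  refine ⟨fun i => vec x (mixedBlock w i), n, fun m => max (q m) (M 0 + m),
    fun m => 2 * C ^ p / ρ 0 ^ m,
    fun k => max (r k) (max k (M k + (n (k + 1) + 1))), fun i => ?_, fun m => ?_, ?_, ?_⟩
  · have h1 : vec x (mixedBlock w i) =
        ∑ k ∈ range (i + 1), (1 / 2 : ℝ) ^ k • vec x (w (Nat.pair k i)) := by
      simp only [mixedBlock, vec_eq, map_sum, map_smul]
    simp only [h1]
    calc _ ≤ ∑ k ∈ range (i + 1), (1 / 2 : ℝ) ^ k := by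
          refine norm_sum_le_of_le _ fun k _ => ?_
          rw [norm_smul, (hwP' k i).2.2, mul_one, Real.norm_of_nonneg (by positivity)]
      _ ≤ _ := sum_geometric_two_le _
  · have := hρ0 0
    positivity
  · intro m F hF hFq a
    set A := ‖vec (fun i => vec x (mixedBlock w i)) a‖ with hA
    have hsupp : (restr F a).support ⊆ F := by
      rw [support_restr]; exact fun i hi => (mem_filter.1 hi).2
    have h1 := hq m (restr F a) (schreierNat_subset hF hsupp)
      fun i hi => (le_max_left _ _).trans (hFq i (hsupp hi))
    have h2 := h.norm_comb_le hwb (hu 0) hF (fun i _ => Nat.zero_le i)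
      (fun i hi => (le_max_right _ _).trans (hFq i hi)) a
    rw [pow_zero, one_mul] at h2
    rw [lmass_restr hp, vpow, ← ENNReal.ofReal_pow (hρ0 0).le,
      ← ENNReal.ofReal_mul (pow_nonneg (hρ0 0).le _), ← ENNReal.ofReal_ofNat 2,
      ← ENNReal.ofReal_mul two_pos.le, ENNReal.ofReal_le_ofReal_iff (by positivity)] at h1
    have h3 := Real.rpow_le_rpow (norm_nonneg _) h2 hp0.le
    rw [Real.mul_rpow hC0.le (norm_nonneg _)] at h3
    have hρm : 0 < ρ 0 ^ m := pow_pos (hρ0 0) m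
    rw [div_mul_eq_mul_div, le_div_iff₀ hρm]
    calc _ = ρ 0 ^ m * ∑ i ∈ F, |a i| ^ p := mul_comm _ _
      _ ≤ _ := h1
      _ ≤ 2 * (C ^ p * A ^ p) := by gcongr
      _ = _ := by ring
  · intro k F hF hFr a ha hG
    have hsupp : (restr F a).support ⊆ F := by
      rw [support_restr]; exact fun i hi => (mem_filter.1 hi).2
    have hη0 : (0 : ℝ) ≤ ((1 / 4 : ℝ) ^ k) ^ p := by positivity
    have h1 := hr k (restr F a) (schreierNat_subset hF hsupp)
      fun i hi => (le_max_left _ _).trans (hFr i (hsupp hi))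
    have h2 := h.norm_comb_le hwb (hu k) hF
      (fun i hi => ((le_max_left _ _).trans (le_max_right _ _)).trans (hFr i hi))
      (fun i hi => ((le_max_right _ _).trans (le_max_right _ _)).trans (hFr i hi)) a
    have h3 : ‖vec x (comb (fun i => w (Nat.pair k i)) (restr F a))‖ ^ p ≤ (2 ^ k * C) ^ p := by
      refine Real.rpow_le_rpow (norm_nonneg _) (h2.trans ?_) hp0.le
      exact mul_le_of_le_one_right (by positivity) ha
    have h4 : tpow p TZ (restr F a) ≤
        ENNReal.ofReal (((1 / 4 : ℝ) ^ k) ^ p + ((1 / 4 : ℝ) ^ k) ^ p) := by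
      rw [ENNReal.ofReal_add hη0 hη0]
      refine h1.trans (add_le_add (gmass_restr_le hp hG) ?_)
      rw [vpow, ← ENNReal.ofReal_ofNat 4, ← ENNReal.ofReal_mul (by norm_num),
        ← ENNReal.ofReal_mul (by have := hK0 k; positivity)]
      refine ENNReal.ofReal_le_ofReal ?_
      calc _ ≤ 4 * K k * (2 ^ k * C) ^ p :=
            mul_le_mul_of_nonneg_left h3 (by have := hK0 k; positivity)
        _ = _ := by
            have : (2 ^ k * C) ^ p ≠ 0 := by positivity
            simp only [hK]
            field_simp
    rw [tpow, ENNReal.ofReal_le_ofReal_iff (by positivity)] at h4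
    have h5 : TZ (restr F a) ≤ 2 * (1 / 4 : ℝ) ^ k := by
      have h6 : TZ (restr F a) ^ p ≤ (2 * (1 / 4 : ℝ) ^ k) ^ p := by
        refine h4.trans ?_
        rw [Real.mul_rpow two_pos.le (by positivity), ← two_mul]
        gcongr
        calc (2 : ℝ) = 2 ^ (1 : ℝ) := (Real.rpow_one 2).symm
          _ ≤ _ := Real.rpow_le_rpow_of_exponent_le one_le_two hp
      exact (Real.rpow_le_rpow_iff (h.isNorm.nonneg _) (by positivity) hp0).1 h6
    have h7 : (restr F a).support ∈ SchreierOmega :=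
      ⟨n (k + 1) + 1, schreierNat_subset hF hsupp, fun i hi =>
        ((Nat.le_add_left _ _).trans
          ((le_max_right _ _).trans (le_max_right _ _))).trans (hFr i (hsupp hi))⟩
    have h8 := h.norm_le _ h7
    rw [vec_restr] at h8
    refine h8.trans ?_
    calc _ ≤ C * (2 * (1 / 4 : ℝ) ^ k) := by gcongr
      _ = _ := by ring

end OmegaTsirelson

section NearUnit

variable {X : Type*} [NormedAddCommGroup X] [NormedSpace ℝ X]

/-- `a` is supported in `A ∩ [q, ∞)`, the vector `∑ a_i y_i` is normalized and within `δ` of the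
subspace `V`. -/
def NearUnit (y : ℕ → X) (A : Set ℕ) (V : Submodule ℝ X) (q : ℕ) (δ : ℝ) (a : ℕ →₀ ℝ) : Prop :=
  (∀ i ∈ a.support, i ∈ A ∧ q ≤ i) ∧ ‖vec y a‖ = 1 ∧ ∃ v ∈ V, ‖v - vec y a‖ ≤ δ

variable {y : ℕ → X} {A : Set ℕ} {V : Submodule ℝ X}

theorem NearUnit.mono {q q' : ℕ} {δ δ' : ℝ} {a : ℕ →₀ ℝ} (h : NearUnit y A V q' δ' a)
    (hq : q ≤ q') (hδ : δ' ≤ δ) : NearUnit y A V q δ a :=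
  ⟨fun i hi => ⟨(h.1 i hi).1, hq.trans (h.1 i hi).2⟩, h.2.1,
    let ⟨v, hv, hva⟩ := h.2.2; ⟨v, hv, hva.trans hδ⟩⟩

theorem NearUnit.normalize {q : ℕ} {δ ε : ℝ} {a : ℕ →₀ ℝ}
    (ha : ∀ i ∈ a.support, i ∈ A ∧ q ≤ i) (h0 : 0 < ‖vec y a‖) {v : X} (hv : v ∈ V)
    (hva : ‖v - vec y a‖ ≤ ε) (hε : ε ≤ δ * ‖vec y a‖) :
    NearUnit y A V q δ (‖vec y a‖⁻¹ • a) := by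
  have h1 : 0 < ‖vec y a‖⁻¹ := inv_pos.2 h0
  refine ⟨fun i hi => ha i (Finsupp.support_smul hi), ?_, ‖vec y a‖⁻¹ • v, V.smul_mem _ hv, ?_⟩
  · rw [vec_smul, norm_smul, Real.norm_of_nonneg h1.le, inv_mul_cancel₀ h0.ne']
  · rw [vec_smul, ← smul_sub, norm_smul, Real.norm_of_nonneg h1.le, inv_mul_le_iff₀ h0]
    linarith [mul_comm δ ‖vec y a‖]

theorem exists_ne_zero_mem_tail
    (hV : V ≤ (Submodule.span ℝ (y '' A)).topologicalClosure)
    (hinf : ¬ FiniteDimensional ℝ V) (q : ℕ) :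
    ∃ v ∈ V, v ∈ (Submodule.span ℝ (y '' {i | i ∈ A ∧ q ≤ i})).topologicalClosure ∧ v ≠ 0 := by
  set W := (Submodule.span ℝ (y '' {i | i ∈ A ∧ q ≤ i})).topologicalClosure with hW
  set L := Submodule.span ℝ (y '' {i | i ∈ A ∧ i < q}) with hL
  have : FiniteDimensional ℝ L :=
    FiniteDimensional.span_of_finite ℝ
      (((Set.finite_lt_nat q).subset fun i hi => hi.2).image y)
  have hWL : V ≤ W ⊔ L := by
    refine hV.trans (Submodule.topologicalClosure_minimal _ (Submodule.span_le.2 ?_)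
      (Submodule.isClosed_sup_finiteDimensional _ _ (Submodule.isClosed_topologicalClosure _)))
    rintro _ ⟨i, hi, rfl⟩
    rcases lt_or_ge i q with hiq | hiq
    · exact Submodule.mem_sup_right (Submodule.subset_span ⟨i, ⟨hi, hiq⟩, rfl⟩)
    · exact Submodule.mem_sup_left
        (Submodule.le_topologicalClosure _ (Submodule.subset_span ⟨i, ⟨hi, hiq⟩, rfl⟩))
  by_contra! hcon
  refine hinf ?_
  have hmem : ∀ v : V, W.mkQ v ∈ L.map W.mkQ := by
    rintro ⟨v, hv⟩
    obtain ⟨w, hw, l, hl, rfl⟩ := Submodule.mem_sup.1 (hWL hv)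
    refine ⟨l, hl, ?_⟩
    simp [(Submodule.Quotient.mk_eq_zero W).2 hw]
  have hinj : Function.Injective
      (LinearMap.codRestrict (L.map W.mkQ) (W.mkQ.comp V.subtype) hmem) := by
    rw [injective_iff_map_eq_zero]
    rintro ⟨v, hv⟩ h0
    have h1 : W.mkQ v = 0 := congrArg Subtype.val h0
    rw [Submodule.mkQ_apply, Submodule.Quotient.mk_eq_zero] at h1
    simpa using hcon v hv h1
  exact FiniteDimensional.of_injective _ hinj

theorem exists_nearUnit (hV : V ≤ (Submodule.span ℝ (y '' A)).topologicalClosure)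
    (hinf : ¬ FiniteDimensional ℝ V) (q : ℕ) {δ : ℝ} (hδ : 0 < δ) :
    ∃ a, NearUnit y A V q δ a := by
  obtain ⟨v, hv, hvW, hv0⟩ := exists_ne_zero_mem_tail hV hinf q
  have hv1 : 0 < ‖v‖ := norm_pos_iff.2 hv0
  have hε : 0 < δ / (1 + δ) * ‖v‖ := by positivity
  obtain ⟨z, hz, hvz⟩ := Metric.mem_closure_iff.1 hvW _ hε
  obtain ⟨a, ha, rfl⟩ := (Finsupp.mem_span_image_iff_linearCombination ℝ).1 hz
  rw [← vec_eq, dist_eq_norm] at hvz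
  have h1 : ‖v‖ ≤ ‖v - vec y a‖ + ‖vec y a‖ := by
    simpa using norm_add_le (v - vec y a) (vec y a)
  have h2 : δ / (1 + δ) * ‖v‖ * (1 + δ) = δ * ‖v‖ := by field_simp
  have h3 : δ / (1 + δ) * ‖v‖ < ‖v‖ := by
    have : δ / (1 + δ) < 1 := (div_lt_one (by positivity)).2 (by linarith)
    nlinarith
  refine ⟨_, NearUnit.normalize (fun i hi => ha hi) (by linarith) hv hvz.le ?_⟩
  nlinarith

variable {p : ℝ}

/-- A vector `a` close to a multiple of a sum of `K` successive normalized blocks. -/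
theorem exists_spread (hp : 1 ≤ p) {m q₀ : ℕ} {𝒢 : Set (Finset ℕ)} {M δ₀ : ℝ} (hM : 0 ≤ M)
    (hδ₀ : 0 < δ₀)
    (hcov : ∀ q : ℕ, ∃ K : ℝ, 0 ≤ K ∧ ∀ δ : ℝ, 0 ≤ δ → ∀ a : ℕ →₀ ℝ,
      (∀ F ∈ 𝒢, ∑ i ∈ F, |a i| ^ p ≤ δ) → (∀ i ∈ a.support, q ≤ i) →
      ∀ F ∈ SchreierNat m, (∃ i ∈ F, i < q) → ∑ i ∈ F, |a i| ^ p ≤ K * δ)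
    (h𝒢 : ∀ (q : ℕ) (δ : ℝ), 0 < δ →
      ∃ a, NearUnit y A V q δ a ∧ ∀ F ∈ 𝒢, ∑ i ∈ F, |a i| ^ p ≤ δ)
    (hbound : ∀ a, NearUnit y A V q₀ δ₀ a → ∀ F ∈ SchreierNat m, ∑ i ∈ F, |a i| ^ p ≤ M)
    (hlarge : ∀ a, NearUnit y A V q₀ δ₀ a → ∃ F ∈ SchreierNat m, δ₀ ≤ ∑ i ∈ F, |a i| ^ p)
    {q₁ : ℕ} (hq₁ : q₀ ≤ q₁) {ε : ℝ} (hε : 0 < ε) (K : ℕ) :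
    ∃ a : ℕ →₀ ℝ, (∀ i ∈ a.support, i ∈ A ∧ q₁ ≤ i) ∧ (∃ v ∈ V, ‖v - vec y a‖ ≤ K * ε) ∧
      (∀ F ∈ SchreierNat m, ∑ i ∈ F, |a i| ^ p ≤ M + K * ε) ∧
      ∃ H ⊆ a.support, Cov m K H ∧ K * δ₀ ≤ ∑ i ∈ H, |a i| ^ p := by
  have hp0 : p ≠ 0 := by positivity
  induction K with
  | zero =>
    refine ⟨0, by simp, ⟨0, V.zero_mem, by simp [vec]⟩, ?_, ∅, by simp, Cov.empty _ _, by simp⟩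
    simp [Real.zero_rpow hp0, hM]
  | succ K ih =>
    obtain ⟨a, ha, ⟨v, hv, hva⟩, haF, H, hHa, hH, hHK⟩ := ih
    obtain ⟨q₂, hq₂, haq₂⟩ : ∃ q₂ ≥ q₁, ∀ i ∈ a.support, i < q₂ :=
      ⟨max q₁ (a.support.sup id + 1), le_max_left _ _, fun i hi =>
        lt_max_of_lt_right (Nat.lt_succ_of_le (le_sup (f := id) hi))⟩
    obtain ⟨K', hK', hcovq⟩ := hcov q₂
    obtain ⟨δ, hδ, hδ0, hδε, hδK⟩ : ∃ δ > 0, δ ≤ δ₀ ∧ δ ≤ ε ∧ K' * δ ≤ ε := by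
      refine ⟨min δ₀ (ε / (K' + 1)), by positivity, min_le_left _ _, ?_, ?_⟩
      · exact (min_le_right _ _).trans (div_le_self hε.le (by linarith))
      · calc _ ≤ (K' + 1) * (ε / (K' + 1)) := by
              gcongr
              · linarith
              · exact min_le_right _ _
          _ = _ := by field_simp
    obtain ⟨w, hw, hwG⟩ := h𝒢 q₂ δ hδ
    have hw₀ : NearUnit y A V q₀ δ₀ w := hw.mono (hq₁.trans hq₂) hδ0
    obtain ⟨F₀, hF₀, hF₀w⟩ := hlarge w hw₀
    obtain ⟨hws, -, u, hu, huw⟩ := hw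
    have haw : ∀ i, q₂ ≤ i → a i = 0 := fun i hi => by
      by_contra h0
      exact absurd (haq₂ i (Finsupp.mem_support_iff.2 h0)) (by omega)
    have hwa : ∀ i, i < q₂ → w i = 0 := fun i hi => by
      by_contra h0
      exact absurd (hws i (Finsupp.mem_support_iff.2 h0)).2 (by omega)
    have hadd : ∀ i, |(a + w) i| ^ p = |a i| ^ p + |w i| ^ p := by
      intro i
      rcases lt_or_ge i q₂ with hi | hi
      · simp [hwa i hi, Real.zero_rpow hp0]
      · simp [haw i hi, Real.zero_rpow hp0]
    refine ⟨a + w, fun i hi => ?_, ⟨v + u, V.add_mem hv hu, ?_⟩, fun F hF => ?_,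
      H ∪ F₀.filter (· ∈ w.support), ?_, ?_, ?_⟩
    · rcases mem_union.1 (Finsupp.support_add hi) with h | h
      · exact ha i h
      · exact ⟨(hws i h).1, hq₂.trans (hws i h).2⟩
    · have : v + u - vec y (a + w) = (v - vec y a) + (u - vec y w) := by
        rw [vec_eq, map_add, ← vec_eq, ← vec_eq]
        abel
      rw [this]
      push_cast
      linarith [norm_add_le (v - vec y a) (u - vec y w)]
    · simp only [hadd, sum_add_distrib]
      push_cast
      by_cases h : ∃ i ∈ F, i < q₂
      · linarith [haF F hF, hcovq δ hδ.le w hwG (fun i hi => (hws i hi).2) F hF h]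
      · push Not at h
        have h1 : ∑ i ∈ F, |a i| ^ p = 0 := sum_eq_zero fun i hi => by
          simp [haw i (h i hi), Real.zero_rpow hp0]
        have h2 : 0 ≤ (K : ℝ) * ε := by positivity
        linarith [hbound w hw₀ F hF]
    · intro i hi
      rw [Finsupp.mem_support_iff]
      rcases mem_union.1 hi with h | h
      · have h1 := haq₂ i (hHa h)
        simpa [hwa i h1] using hHa h
      · have h1 := (mem_filter.1 h).2
        simpa [haw i (hws i h1).2] using h1
    · exact hH.union (Cov.of_mem (schreierNat_subset hF₀ (filter_subset _ _)))
    · have hdisj : Disjoint H (F₀.filter (· ∈ w.support)) := by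
        refine disjoint_left.2 fun i h1 h2 => ?_
        have h3 := haq₂ i (hHa h1)
        have h4 := (hws i (mem_filter.1 h2).2).2
        omega
      rw [sum_union hdisj]
      have h1 : ∑ i ∈ F₀.filter (· ∈ w.support), |w i| ^ p = ∑ i ∈ F₀, |w i| ^ p := by
        rw [sum_filter]
        refine sum_congr rfl fun i _ => ?_
        split_ifs with h
        · rfl
        · rw [Finsupp.notMem_support_iff.1 h, abs_zero, Real.zero_rpow hp0]
      have h2 : ∑ i ∈ H, |a i| ^ p ≤ ∑ i ∈ H, |(a + w) i| ^ p :=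
        sum_le_sum fun i _ => by rw [hadd]; exact le_add_of_nonneg_right (by positivity)
      have h3 : ∑ i ∈ F₀.filter (· ∈ w.support), |w i| ^ p ≤
          ∑ i ∈ F₀.filter (· ∈ w.support), |(a + w) i| ^ p :=
        sum_le_sum fun i _ => by rw [hadd]; exact le_add_of_nonneg_left (by positivity)
      rw [Nat.cast_add_one]
      linarith

theorem exists_flat_step (hp : 1 ≤ p) {m : ℕ} {𝒢 : Set (Finset ℕ)} {q : ℕ → ℕ} {D : ℕ → ℝ}
    (hD : ∀ m, 0 < D m)
    (hmass : ∀ m, ∀ F ∈ SchreierNat m, (∀ i ∈ F, q m ≤ i) → ∀ a : ℕ →₀ ℝ,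
        ∑ i ∈ F, |a i| ^ p ≤ D m * ‖vec y a‖ ^ p)
    (hcov : ∀ q : ℕ, ∃ K : ℝ, 0 ≤ K ∧ ∀ δ : ℝ, 0 ≤ δ → ∀ a : ℕ →₀ ℝ,
      (∀ F ∈ 𝒢, ∑ i ∈ F, |a i| ^ p ≤ δ) → (∀ i ∈ a.support, q ≤ i) →
      ∀ F ∈ SchreierNat m, (∃ i ∈ F, i < q) → ∑ i ∈ F, |a i| ^ p ≤ K * δ)
    (h𝒢 : ∀ (q : ℕ) (δ : ℝ), 0 < δ →
      ∃ a, NearUnit y A V q δ a ∧ ∀ F ∈ 𝒢, ∑ i ∈ F, |a i| ^ p ≤ δ)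
    (q₀ : ℕ) {δ₀ : ℝ} (hδ₀ : 0 < δ₀) :
    ∃ a, NearUnit y A V q₀ δ₀ a ∧ ∀ F ∈ SchreierNat m, ∑ i ∈ F, |a i| ^ p ≤ δ₀ := by
  have hp0 : p ≠ 0 := by positivity
  by_contra! hcon
  have hbound : ∀ a, NearUnit y A V (max q₀ (q m)) δ₀ a →
      ∀ F ∈ SchreierNat m, ∑ i ∈ F, |a i| ^ p ≤ D m := by
    intro a ha F hF
    have h1 := hmass m _ (schreierNat_subset hF (filter_subset (· ∈ a.support) _))
      (fun i hi => (le_max_right _ _).trans (ha.1 i (mem_filter.1 hi).2).2) a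
    rw [ha.2.1, Real.one_rpow, mul_one, sum_filter] at h1
    refine (sum_congr rfl fun i _ => ?_).trans_le h1
    split_ifs with h
    · rfl
    · rw [Finsupp.notMem_support_iff.1 h, abs_zero, Real.zero_rpow hp0]
  have hlarge : ∀ a, NearUnit y A V (max q₀ (q m)) δ₀ a →
      ∃ F ∈ SchreierNat m, δ₀ ≤ ∑ i ∈ F, |a i| ^ p := fun a ha =>
    let ⟨F, hF, h⟩ := hcon a (ha.mono (le_max_left _ _) le_rfl)
    ⟨F, hF, h.le⟩
  have hDm := hD m
  have hDm' := hD (m + 1)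
  obtain ⟨K, hK⟩ := exists_nat_ge (D (m + 1) * ((D m + 1) / δ₀ + (1 / δ₀) ^ p) / δ₀)
  rw [div_le_iff₀ hδ₀] at hK
  obtain ⟨a, ha, ⟨v, hv, hva⟩, haF, H, hHa, hH, hHK⟩ :=
    exists_spread hp hDm.le hδ₀ hcov h𝒢 hbound hlarge
      (q₁ := max (max q₀ (q m)) (max K (q (m + 1)))) (le_max_left _ _)
      (ε := 1 / (K + 1)) (by positivity) K
  have hKε : (K : ℝ) * (1 / (K + 1)) ≤ 1 := by
    rw [mul_one_div, div_le_one (by positivity)]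
    linarith
  have h1 := hmass (m + 1) H (hH.mem_of_le fun i hi =>
      ((le_max_left _ _).trans (le_max_right _ _)).trans (ha i (hHa hi)).2)
    (fun i hi => ((le_max_right _ _).trans (le_max_right _ _)).trans (ha i (hHa hi)).2) a
  have h2 : (D m + 1) / δ₀ + (1 / δ₀) ^ p ≤ ‖vec y a‖ ^ p :=
    le_of_mul_le_mul_left (hK.trans (hHK.trans h1)) hDm'
  have h3 : 1 / δ₀ ≤ ‖vec y a‖ := by
    refine (Real.rpow_le_rpow_iff (by positivity) (norm_nonneg _) (by positivity : 0 < p)).1 ?_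
    have : 0 ≤ (D m + 1) / δ₀ := by positivity
    linarith
  have h4 : (D m + 1) ≤ δ₀ * ‖vec y a‖ ^ p := by
    rw [← div_le_iff₀' hδ₀]
    have : 0 ≤ (1 / δ₀) ^ p := by positivity
    linarith
  have h5 : 0 < ‖vec y a‖ := lt_of_lt_of_le (by positivity) h3
  obtain ⟨F, hF, hlt⟩ := hcon _ (NearUnit.normalize (δ := δ₀)
    (fun i hi => ⟨(ha i hi).1, ((le_max_left _ _).trans (le_max_left _ _)).trans (ha i hi).2⟩)
    h5 hv (hva.trans hKε) ((div_le_iff₀' hδ₀).1 h3))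
  refine hlt.not_ge ?_
  have h6 : ∀ i, |(‖vec y a‖⁻¹ • a) i| ^ p = (‖vec y a‖ ^ p)⁻¹ * |a i| ^ p := by
    intro i
    rw [Finsupp.smul_apply, smul_eq_mul, abs_mul, abs_of_pos (inv_pos.2 h5),
      Real.mul_rpow (by positivity) (abs_nonneg _), Real.inv_rpow h5.le]
  simp only [h6, ← mul_sum]
  rw [inv_mul_le_iff₀ (by positivity)]
  linarith [haF F hF]

theorem exists_flat (hp : 1 ≤ p) {q : ℕ → ℕ} {D : ℕ → ℝ} (hD : ∀ m, 0 < D m)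
    (hmass : ∀ m, ∀ F ∈ SchreierNat m, (∀ i ∈ F, q m ≤ i) → ∀ a : ℕ →₀ ℝ,
        ∑ i ∈ F, |a i| ^ p ≤ D m * ‖vec y a‖ ^ p)
    (hV : V ≤ (Submodule.span ℝ (y '' A)).topologicalClosure)
    (hinf : ¬ FiniteDimensional ℝ V) (m q₀ : ℕ) {δ : ℝ} (hδ : 0 < δ) :
    ∃ a, NearUnit y A V q₀ δ a ∧ ∀ F ∈ SchreierNat m, ∑ i ∈ F, |a i| ^ p ≤ δ := by
  have hp0 : p ≠ 0 := by positivity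
  induction m generalizing q₀ δ with
  | zero =>
    refine exists_flat_step hp (𝒢 := ∅) hD hmass (fun q' => ⟨0, le_rfl, ?_⟩) ?_ q₀ hδ
    · rintro ε - a - ha F hF ⟨i, hi, hiq⟩
      have hFi : F = {i} := (card_eq_one.1 (le_antisymm hF (card_pos.2 ⟨i, hi⟩))).elim
        fun j hj => by subst hj; rw [mem_singleton.1 hi]
      have : a i = 0 := by
        by_contra h0
        exact absurd (ha i (Finsupp.mem_support_iff.2 h0)) (by omega)
      simp [hFi, this, Real.zero_rpow hp0]
    · intro q' ε hε
      obtain ⟨a, ha⟩ := exists_nearUnit hV hinf q' hε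
      exact ⟨a, ha, by simp⟩
  | succ m ih =>
    refine exists_flat_step hp (𝒢 := SchreierNat m) hD hmass
      (fun q' => ⟨q', Nat.cast_nonneg _, ?_⟩) (fun q' ε hε => ih q' hε) q₀ hδ
    rintro ε hε a hG - F hF ⟨i, hi, hiq⟩
    obtain ⟨k, hk, hc⟩ := mem_schreierNat_succ.1 hF
    have h1 : ∀ k F, Cov m k F → ∑ i ∈ F, |a i| ^ p ≤ k * ε := by
      intro k
      induction k with
      | zero => rintro F rfl; simp
      | succ k ihk =>
        rintro _ ⟨B, R, rfl, hBR, hB, hR⟩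
        have hdisj : Disjoint B R := disjoint_left.2 fun i h1 h2 => (hBR i h1 i h2).false
        rw [sum_union hdisj]
        push_cast
        linarith [ihk B hB, hG R hR]
    refine (h1 k F hc).trans ?_
    gcongr
    exact (hk i hi).trans hiq.le

end NearUnit

section Extension

variable {X : Type*} [NormedAddCommGroup X] [NormedSpace ℝ X] {x y : ℕ → X} {A : Set ℕ}

theorem vec_mem_closedSpan {a : ℕ →₀ ℝ} (ha : ∀ i ∈ a.support, i ∈ A) :
    vec y a ∈ (Submodule.span ℝ (y '' A)).topologicalClosure :=
  Submodule.le_topologicalClosure _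
    ((Finsupp.mem_span_image_iff_linearCombination ℝ).2 ⟨a, ha, rfl⟩)

theorem norm_vec_le_mul_of_le {δ M : ℝ} (hδ : 0 < δ)
    (h : ∀ a : ℕ →₀ ℝ, (∀ i ∈ a.support, i ∈ A) → ‖vec y a‖ ≤ δ → ‖vec x a‖ ≤ M)
    {a : ℕ →₀ ℝ} (ha : ∀ i ∈ a.support, i ∈ A) : ‖vec x a‖ ≤ M / δ * ‖vec y a‖ := by
  have hsmul : ∀ c : ℝ, 0 ≤ c → c * ‖vec y a‖ ≤ δ → c * ‖vec x a‖ ≤ M := by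
    intro c hc hcy
    have := h (c • a) (fun i hi => ha i (Finsupp.support_smul hi))
      (by rwa [vec_smul, norm_smul, Real.norm_of_nonneg hc])
    rwa [vec_smul, norm_smul, Real.norm_of_nonneg hc] at this
  rcases eq_or_ne ‖vec y a‖ 0 with h0 | h0
  · rw [h0, mul_zero]
    by_contra! hpos
    obtain ⟨N, hN⟩ := exists_nat_gt (M / ‖vec x a‖)
    rw [div_lt_iff₀ hpos] at hN
    exact (hsmul N N.cast_nonneg (by rw [h0, mul_zero]; exact hδ.le)).not_gt hN
  · have hpos : 0 < ‖vec y a‖ := lt_of_le_of_ne (norm_nonneg _) h0.symm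
    have := hsmul (δ / ‖vec y a‖) (by positivity) (div_mul_cancel₀ _ h0).le
    rw [div_mul_eq_mul_div, le_div_iff₀ hδ]
    rw [div_mul_eq_mul_div, div_le_iff₀ hpos] at this
    linarith

theorem exists_extendOfNorm {E : Type*} [AddCommGroup E] [Module ℝ E] [CompleteSpace X]
    {S : Submodule ℝ E} {V : Submodule ℝ X} {f : S →ₗ[ℝ] X} {e : S →ₗ[ℝ] V} (he : DenseRange e)
    {K : ℝ} (h : ∀ a, ‖f a‖ ≤ K * ‖e a‖) : ∃ T : V →L[ℝ] X, ∀ a, T (e a) = f a :=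
  ⟨f.extendOfNorm e, LinearMap.extendOfNorm_eq he ⟨K, h⟩⟩

theorem exists_extension [CompleteSpace X] {K : ℝ}
    (h : ∀ a : ℕ →₀ ℝ, (∀ i ∈ a.support, i ∈ A) → ‖vec x a‖ ≤ K * ‖vec y a‖) :
    ∃ T : ↥(Submodule.span ℝ (y '' A)).topologicalClosure →L[ℝ] X,
      ∀ (a : ℕ →₀ ℝ) (ha : ∀ i ∈ a.support, i ∈ A),
        T ⟨vec y a, vec_mem_closedSpan ha⟩ = vec x a := by
  obtain ⟨S, hS⟩ : ∃ S : Submodule ℝ (ℕ →₀ ℝ), ∀ a, a ∈ S ↔ ∀ i ∈ a.support, i ∈ A :=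
    ⟨Finsupp.supported ℝ ℝ A, fun a => Iff.rfl⟩
  have hmem : ∀ a : S, ∀ i ∈ (a : ℕ →₀ ℝ).support, i ∈ A := fun a => (hS a).1 a.2
  obtain ⟨e, he⟩ : ∃ e : S →ₗ[ℝ] ↥(Submodule.span ℝ (y '' A)).topologicalClosure,
      ∀ a, e a = ⟨vec y a, vec_mem_closedSpan (hmem a)⟩ :=
    ⟨LinearMap.codRestrict _ (Finsupp.linearCombination ℝ y ∘ₗ S.subtype)
      fun a => vec_mem_closedSpan (hmem a), fun a => rfl⟩
  obtain ⟨f, hf⟩ : ∃ f : S →ₗ[ℝ] X, ∀ a, f a = vec x a :=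
    ⟨Finsupp.linearCombination ℝ x ∘ₗ S.subtype, fun a => rfl⟩
  have hdense : DenseRange e := by
    rintro ⟨v, hv⟩
    rw [Metric.mem_closure_iff]
    intro ε hε
    obtain ⟨z, hz, hvz⟩ := Metric.mem_closure_iff.1 hv ε hε
    obtain ⟨a, ha, rfl⟩ := (Finsupp.mem_span_image_iff_linearCombination ℝ).1 hz
    refine ⟨e ⟨a, (hS a).2 ha⟩, ⟨_, rfl⟩, ?_⟩
    rw [he]
    exact hvz
  obtain ⟨T, hT⟩ := exists_extendOfNorm hdense (f := f) (K := K) fun a => by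
    rw [hf, he]
    exact h _ (hmem a)
  refine ⟨T, fun a ha => ?_⟩
  have haS : a ∈ S := (hS a).2 ha
  rw [← hf ⟨a, haS⟩, ← hT, he]

end Extension

namespace OmegaTsirelson

variable {X : Type*} [NormedAddCommGroup X] [NormedSpace ℝ X]
  {p : ℝ} {θ : ℕ → ℝ} {TZ : (ℕ →₀ ℝ) → ℝ} {x y : ℕ → X} {C : ℝ}

/-- If the masses of `a` on the sets of `S_{n k}` are at most `(1/4)^{kp}`, then on a sparse set
of coordinates the norm of `∑ a_i x_i` is at most `6 C (1/4)^k`. -/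
theorem norm_sum_le_of_flat (hC : 0 ≤ C) {n q r Q : ℕ → ℕ} {D : ℕ → ℝ}
    (hmass : ∀ m, ∀ F ∈ SchreierNat m, (∀ i ∈ F, q m ≤ i) → ∀ a : ℕ →₀ ℝ,
        ∑ i ∈ F, |a i| ^ p ≤ D m * ‖vec y a‖ ^ p)
    (hx : ∀ k, ∀ F ∈ SchreierNat (n (k + 1) + 1), (∀ i ∈ F, r k ≤ i) → ∀ a : ℕ →₀ ℝ,
        ‖vec y a‖ ≤ 1 →
        (∀ G ⊆ F, G ∈ SchreierNat (n k) → ∑ i ∈ G, |a i| ^ p ≤ ((1 / 4 : ℝ) ^ k) ^ p) →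
        ‖∑ i ∈ F, a i • x i‖ ≤ 2 * C * (1 / 4 : ℝ) ^ k)
    (hp : 1 ≤ p) (hD : ∀ m, 0 < D m) (hQ : StrictMono Q) (hQ1 : ∀ k, 1 ≤ Q k)
    (hQr : ∀ k, r k ≤ Q k) (hQq : ∀ k, q (n (k + 1) + 1) ≤ Q k)
    (hQD : ∀ k, D (n (k + 1) + 1) < ((1 / 4 : ℝ) ^ (k + 1)) ^ p * Q k)
    {a : ℕ →₀ ℝ} (ha : ‖vec y a‖ ≤ 1) (d k : ℕ) (B : Finset ℕ)
    (hB : B ⊆ (Ico k (k + d)).image Q)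
    (hflat : ∀ G ⊆ B, G ∈ SchreierNat (n k) → ∑ i ∈ G, |a i| ^ p ≤ ((1 / 4 : ℝ) ^ k) ^ p) :
    ‖∑ i ∈ B, a i • x i‖ ≤ 6 * C * (1 / 4 : ℝ) ^ k := by
  induction d generalizing k B with
  | zero =>
    have : B = ∅ := by simpa using hB
    subst this
    simp
    positivity
  | succ d ih =>
    have hBQ : ∀ i ∈ B, Q k ≤ i := fun i hi => by
      obtain ⟨j, hj, rfl⟩ := mem_image.1 (hB hi)
      exact hQ.monotone (mem_Ico.1 hj).1
    obtain ⟨H, hHB, hH, hrest⟩ := exists_removal (f := fun i => |a i| ^ p) (n := n (k + 1))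
      (η := ((1 / 4 : ℝ) ^ (k + 1)) ^ p) (M := D (n (k + 1) + 1)) (B := B) (by positivity)
      (fun F hFB hF => by
        refine (hmass _ F hF (fun i hi => (hQq k).trans (hBQ i (hFB hi))) a).trans ?_
        refine mul_le_of_le_one_right (hD _).le (Real.rpow_le_one (norm_nonneg _) ha ?_)
        linarith)
      (fun i hi => (hQD k).trans_le (by
        have : (Q k : ℝ) ≤ i := by exact_mod_cast hBQ i hi
        gcongr))
    set E := (B \ H).filter (· = Q k) with hE
    set R := (B \ H).filter (¬ · = Q k) with hR
    have hEB : E ⊆ B := (filter_subset _ _).trans sdiff_subset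
    have hRB : R ⊆ B \ H := filter_subset _ _
    have hE0 : E ∈ SchreierNat (n (k + 1) + 1) := by
      refine schreierNat_mono (schreierNat_subset (singleton_mem_schreierNat_zero (Q k)) ?_)
        (Nat.zero_le _) fun i hi => (hQ1 k).trans (hBQ i (hEB hi))
      intro i hi
      exact mem_singleton.2 (mem_filter.1 hi).2
    have h1 := hx k H hH (fun i hi => (hQr k).trans (hBQ i (hHB hi))) a ha
      fun G hG => hflat G (hG.trans hHB)
    have h2 := hx k E hE0 (fun i hi => (hQr k).trans (hBQ i (hEB hi))) a ha
      fun G hG => hflat G (hG.trans hEB)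
    have h3 := ih (k + 1) R (fun i hi => by
        obtain ⟨j, hj, rfl⟩ := mem_image.1 (hB (sdiff_subset (hRB hi)))
        refine mem_image_of_mem Q (mem_Ico.2 ⟨?_, ?_⟩)
        · refine lt_of_le_of_ne (mem_Ico.1 hj).1 ?_
          rintro rfl
          exact (mem_filter.1 hi).2 rfl
        · have := (mem_Ico.1 hj).2
          omega)
      fun G hG hGn => hrest G (hG.trans hRB) hGn
    have hsum : ∑ i ∈ B, a i • x i =
        (∑ i ∈ E, a i • x i + ∑ i ∈ R, a i • x i) + ∑ i ∈ H, a i • x i := by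
      rw [hE, hR, sum_filter_add_sum_filter_not, sum_sdiff hHB]
    rw [hsum]
    have h4 : (1 / 4 : ℝ) ^ (k + 1) = (1 / 4) ^ k / 4 := by rw [pow_succ]; ring
    rw [h4] at h3
    have h5 : 0 ≤ C * (1 / 4 : ℝ) ^ k := by positivity
    have h6 := norm_add_le (∑ i ∈ E, a i • x i + ∑ i ∈ R, a i • x i) (∑ i ∈ H, a i • x i)
    have h7 := norm_add_le (∑ i ∈ E, a i • x i) (∑ i ∈ R, a i • x i)
    nlinarith

theorem one_le_mul_norm_sub (h : OmegaTsirelson p θ TZ x C) {i j : ℕ} (hi : 2 ≤ i) (hj : 2 ≤ j)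
    (hij : i ≠ j) : 1 ≤ C * ‖x i - x j‖ := by
  have hv : vec x (Finsupp.single i 1 - Finsupp.single j 1) = x i - x j := by
    rw [vec_eq, map_sub, ← vec_eq, ← vec_eq, vec_single, vec_single, one_smul, one_smul]
  have hmem : ({i, j} : Finset ℕ) ∈ SchreierOmega := by
    refine ⟨1, ?_, fun a ha => ?_⟩
    · have := (Cov.of_mem (singleton_mem_schreierNat_zero i)).union
        (Cov.of_mem (singleton_mem_schreierNat_zero j))
      refine this.mem_of_le fun a ha => ?_
      simp at ha
      omega
    · simp at ha
      omega
  have hsupp : (Finsupp.single i (1 : ℝ) - Finsupp.single j 1).support ⊆ {i, j} := by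
    intro a ha
    by_contra hcon
    simp only [mem_insert, mem_singleton, not_or] at hcon
    simp [Ne.symm hcon.1, Ne.symm hcon.2] at ha
  have h1 := h.le_norm _ (schreierOmega_subset hmem hsupp)
  rw [hv] at h1
  refine le_trans ?_ h1
  have h2 := h.isNorm.abs_le (Finsupp.single i 1 - Finsupp.single j 1) i
  simpa [Finsupp.single_apply, Ne.symm hij] using h2

/-- Sufficiently sparse subsequences for the removal procedure. -/
theorem exists_sparse (n q r : ℕ → ℕ) (D : ℕ → ℝ) (p : ℝ) :
    ∃ Q : ℕ → ℕ, StrictMono Q ∧ (∀ k, 2 ≤ Q k) ∧ (∀ k, q (n 0) ≤ Q k) ∧ (∀ k, r k ≤ Q k) ∧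
      (∀ k, q (n (k + 1) + 1) ≤ Q k) ∧
      ∀ k, D (n (k + 1) + 1) < ((1 / 4 : ℝ) ^ (k + 1)) ^ p * Q k := by
  choose R hR using fun k => exists_nat_gt (D (n (k + 1) + 1) / ((1 / 4 : ℝ) ^ (k + 1)) ^ p)
  refine ⟨fun k => k + 2 + q (n 0) + ∑ j ∈ range (k + 1), (r j + q (n (j + 1) + 1) + R j),
    strictMono_nat_of_lt_succ fun k => ?_, ?_⟩
  · simp only [sum_range_succ _ (k + 1)]
    omega
  · have hle : ∀ k, r k + q (n (k + 1) + 1) + R k ≤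
        ∑ j ∈ range (k + 1), (r j + q (n (j + 1) + 1) + R j) := fun k =>
      single_le_sum (f := fun j => r j + q (n (j + 1) + 1) + R j) (fun _ _ => Nat.zero_le _)
        (self_mem_range_succ k)
    refine ⟨fun k => ?_, fun k => ?_, fun k => ?_, fun k => ?_, fun k => ?_⟩
    iterate 4
      have := hle k
      dsimp only
      omega
    rw [← div_lt_iff₀' (by positivity)]
    refine (hR k).trans_le (Nat.cast_le.2 ?_)
    have := hle k
    dsimp only
    omega

theorem not_isCompactOperator (h : OmegaTsirelson p θ TZ x C) {Q : ℕ → ℕ} (hQ : StrictMono Q)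
    (hQ2 : ∀ k, 2 ≤ Q k) {V : Type*} [NormedAddCommGroup V] [NormedSpace ℝ V] {T : V →L[ℝ] X}
    {z : ℕ → V} {M : ℝ} (hz : ∀ j, ‖z j‖ ≤ M) (hTz : ∀ j, T (z j) = x (Q j)) :
    ¬ IsCompactOperator T := by
  intro hcomp
  obtain ⟨l, -, φ, hφ, hlim⟩ := (hcomp.isCompact_closure_image_closedBall M).tendsto_subseq
    (x := fun j => x (Q j)) fun j =>
      subset_closure ⟨z j, mem_closedBall_zero_iff.2 (hz j), hTz j⟩
  have hC : 0 < C := zero_lt_one.trans_le h.one_le_C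
  obtain ⟨N, hN⟩ := Metric.cauchySeq_iff'.1 hlim.cauchySeq (1 / C) (by positivity)
  have h1 := hN (N + 1) (Nat.le_succ N)
  rw [dist_eq_norm, lt_div_iff₀' hC] at h1
  refine (h.one_le_mul_norm_sub (hQ2 _) (hQ2 _) ?_).not_gt h1
  exact (hQ.comp hφ).injective.ne (Nat.succ_ne_self N)

theorem exists_strictlySingular [CompleteSpace X] (h : OmegaTsirelson p θ TZ x C) {t : ℝ}
    (hlim : Tendsto (fun n : ℕ => θ n ^ (1 / (n : ℝ))) atTop (nhds t))
    (hratio : Tendsto (fun n : ℕ => θ n / t ^ n) atTop (nhds 0)) :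
    ∃ V : Submodule ℝ X, IsClosed (V : Set X) ∧ ¬ FiniteDimensional ℝ V ∧
      ∃ T : ↥V →L[ℝ] X, ¬ IsCompactOperator T ∧ StrictlySingular T := by
  have hp := h.one_le_p
  have hp0 : 0 < p := by linarith
  have hC0 : 0 ≤ C := zero_le_one.trans h.one_le_C
  obtain ⟨y, n, q, D, r, hy, hD, hmass, hx⟩ := h.exists_dominating hlim hratio
  obtain ⟨Q, hQ, hQ2, hQ0, hQr, hQq, hQD⟩ := exists_sparse n q r D p
  have hflat := fun {a : ℕ →₀ ℝ} (ha : ‖vec y a‖ ≤ 1) => norm_sum_le_of_flat hC0 hmass hx hp hD hQ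
    (fun k => one_le_two.trans (hQ2 k)) hQr hQq hQD ha
  have hcover : ∀ (k : ℕ) (a : ℕ →₀ ℝ), (∀ i ∈ a.support, i ∈ Set.range Q ∧ Q k ≤ i) →
      ∃ d, a.support ⊆ (Ico k (k + d)).image Q := by
    intro k a ha
    refine ⟨a.support.sup id + 1, fun i hi => ?_⟩
    obtain ⟨⟨j, rfl⟩, hkj⟩ := ha i hi
    refine mem_image_of_mem Q (mem_Ico.2 ⟨hQ.le_iff_le.1 hkj, ?_⟩)
    have h1 : Q j ≤ a.support.sup id := le_sup (f := id) hi
    have h2 := hQ.le_apply (x := j)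
    omega
  obtain ⟨δ, hδ, hδ1, hδD⟩ : ∃ δ > 0, δ ≤ 1 ∧ D (n 0) * δ ^ p ≤ 1 := by
    have h1 := hD (n 0)
    refine ⟨min 1 ((D (n 0))⁻¹ ^ p⁻¹), by positivity, min_le_left _ _, ?_⟩
    calc _ ≤ D (n 0) * ((D (n 0))⁻¹ ^ p⁻¹) ^ p := by
          gcongr
          exact min_le_right _ _
      _ = 1 := by
          rw [← Real.rpow_mul (by positivity), inv_mul_cancel₀ hp0.ne', Real.rpow_one,
            mul_inv_cancel₀ h1.ne']
  have hsmall : ∀ a : ℕ →₀ ℝ, (∀ i ∈ a.support, i ∈ Set.range Q) → ‖vec y a‖ ≤ δ →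
      ‖vec x a‖ ≤ 6 * C := by
    intro a haQ ha
    have haA : ∀ i ∈ a.support, i ∈ Set.range Q ∧ Q 0 ≤ i := fun i hi => by
      obtain ⟨j, rfl⟩ := haQ i hi
      exact ⟨⟨j, rfl⟩, hQ.monotone (Nat.zero_le j)⟩
    obtain ⟨d, hd⟩ := hcover 0 a haA
    have := hflat (ha.trans hδ1) d 0 _ hd fun G hG hGn => by
      refine (hmass _ G hGn (fun i hi => (hQ0 0).trans (haA i (hG hi)).2) a).trans ?_
      rw [pow_zero, Real.one_rpow]
      have := hD (n 0)
      refine le_trans ?_ hδD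
      gcongr
    simpa [vec, Finsupp.sum] using this
  obtain ⟨T, hT⟩ := exists_extension fun a ha => norm_vec_le_mul_of_le hδ hsmall ha
  have hncomp : ¬ IsCompactOperator T := by
    have hs : ∀ j, ∀ i ∈ (Finsupp.single (Q j) (1 : ℝ)).support, i ∈ Set.range Q :=
      fun j i hi => ⟨j, (mem_singleton.1 (Finsupp.support_single_subset hi)).symm⟩
    refine h.not_isCompactOperator hQ hQ2
      (z := fun j => ⟨vec y (Finsupp.single (Q j) 1), vec_mem_closedSpan (hs j)⟩) (M := 2)
      (fun j => ?_) fun j => ?_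
    · rw [Submodule.coe_norm]
      simp only [vec_single, one_smul, hy]
    · rw [hT _ (hs j), vec_single, one_smul]
  refine ⟨_, Submodule.isClosed_topologicalClosure _, fun hfin => hncomp ?_, T, hncomp, ?_⟩
  · have := FiniteDimensional.proper ℝ ↥(Submodule.span ℝ (y '' Set.range Q)).topologicalClosure
    exact (isCompactOperator_of_locallyCompactSpace_rng T :)
  · rintro U hU ⟨c, hc, hcU⟩
    have hU' : ¬ FiniteDimensional ℝ (U.map (Submodule.subtype _)) := fun hfin =>
      hU ((Submodule.equivMapOfInjective _ (Submodule.injective_subtype _)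
        U).symm.finiteDimensional)
    have hUV : U.map (Submodule.subtype _) ≤
        (Submodule.span ℝ (y '' Set.range Q)).topologicalClosure := by
      rintro _ ⟨v, -, rfl⟩
      exact v.2
    obtain ⟨k, hk⟩ : ∃ k : ℕ, 6 * C * (1 / 4 : ℝ) ^ k < c / 8 := by
      have h1 : 0 < 6 * C := by linarith [h.one_le_C]
      obtain ⟨k, hk⟩ := exists_pow_lt_of_lt_one (y := (1 / 4 : ℝ)) (x := c / 8 / (6 * C))
        (by positivity) (by norm_num)
      exact ⟨k, by rwa [lt_div_iff₀' h1] at hk⟩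
    obtain ⟨ε, hε, hε1, hεT, hεk⟩ : ∃ ε > 0, ε ≤ 1 / 2 ∧ ‖T‖ * ε ≤ c / 8 ∧
        ε ≤ ((1 / 4 : ℝ) ^ k) ^ p := by
      refine ⟨min (min (1 / 2) (((1 / 4 : ℝ) ^ k) ^ p)) (c / 8 / (‖T‖ + 1)), by positivity,
        (min_le_left _ _).trans (min_le_left _ _), ?_, (min_le_left _ _).trans (min_le_right _ _)⟩
      calc _ ≤ (‖T‖ + 1) * (c / 8 / (‖T‖ + 1)) := by
            gcongr
            · linarith
            · exact min_le_right _ _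
        _ = _ := by field_simp
    obtain ⟨a, ⟨ha, ha1, v, ⟨u, hu, rfl⟩, hva⟩, haF⟩ :=
      exists_flat hp hD hmass hUV hU' (n k) (Q k) hε
    obtain ⟨d, hd⟩ := hcover k a ha
    have h1 := hflat ha1.le d k _ hd fun G _ hGn => (haF G hGn).trans hεk
    have haQ : ∀ i ∈ a.support, i ∈ Set.range Q := fun i hi => (ha i hi).1
    obtain ⟨z, hz⟩ : ∃ z : ↥(Submodule.span ℝ (y '' Set.range Q)).topologicalClosure,
        z = ⟨vec y a, vec_mem_closedSpan haQ⟩ := ⟨_, rfl⟩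
    have h2 : ‖T z‖ ≤ 6 * C * (1 / 4 : ℝ) ^ k := by
      rw [hz, hT a haQ]
      exact h1
    have h3 : ‖u - z‖ ≤ ε := by
      rw [hz]
      exact hva
    have h4 : ‖z‖ = 1 := by
      rw [hz]
      exact ha1
    have h5 : ‖T (u - z)‖ ≤ ‖T‖ * ε :=
      (T.le_opNorm _).trans (mul_le_mul_of_nonneg_left h3 (norm_nonneg _))
    have h6 := norm_add_le (T (u - z)) (T z)
    rw [← map_add, sub_add_cancel] at h6
    have h7 := norm_sub_norm_le z u
    rw [norm_sub_rev, h4] at h7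
    have h8 := hcU u hu
    nlinarith

end OmegaTsirelson

/-- Let `X` be a Banach space with an `S_ω`-unconditional basis
`(x_i)` that is `S_ω`-equivalent to the unit vector basis of a regular
`p`-convexified mixed Tsirelson space `T^{(p)}[(S_n, θ_n)_{n∈ℕ}]` with
`θ_n/θ^n → 0`, where `θ = lim_n θ_n^{1/n}`.  Then `X` admits a bounded strictly
singular non-compact operator on an infinite-dimensional closed subspace. -/
theorem statement13 {X : Type*} [NormedAddCommGroup X] [NormedSpace ℝ X]
    [CompleteSpace X]
    (p : ℝ) (hp : 1 ≤ p) (θseq : ℕ → ℝ) (hreg : RegularParams θseq)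
    (θ : ℝ) (hθ : Tendsto (fun n : ℕ => θseq n ^ (1 / (n : ℝ))) atTop (nhds θ))
    (hratio : Tendsto (fun n : ℕ => θseq n / θ ^ n) atTop (nhds 0))
    (TZ : (ℕ →₀ ℝ) → ℝ) (hTZ : IsMixedTsirelsonNorm p Set.univ θseq TZ)
    (x : ℕ → X) (hbasis : IsSchauderBasis x)
    (hunc : FUnconditional SchreierOmega x)
    (hequiv : ∃ C : ℝ, 1 ≤ C ∧ ∀ F ∈ SchreierOmega, ∀ a : ℕ → ℝ,
      (1 / C) * TZ (∑ i ∈ F, Finsupp.single i (a i)) ≤ ‖∑ i ∈ F, a i • x i‖ ∧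
      ‖∑ i ∈ F, a i • x i‖ ≤ C * TZ (∑ i ∈ F, Finsupp.single i (a i))) :
    ∃ V : Submodule ℝ X, IsClosed (V : Set X) ∧ ¬ FiniteDimensional ℝ V ∧
      ∃ T : ↥V →L[ℝ] X, ¬ IsCompactOperator T ∧ StrictlySingular T := by
  obtain ⟨Cu, hCu, hu⟩ := hunc
  obtain ⟨Ce, hCe, he⟩ := hequiv
  have hsum : ∀ v : ℕ →₀ ℝ, ∑ i ∈ v.support, Finsupp.single i (v i) = v := Finsupp.sum_single
  have hle : ∀ c : ℝ, 0 ≤ c → Cu * c ≤ max Cu Ce * c ∧ Ce * c ≤ max Cu Ce * c := fun c hc =>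
    ⟨mul_le_mul_of_nonneg_right (le_max_left _ _) hc,
      mul_le_mul_of_nonneg_right (le_max_right _ _) hc⟩
  have h : OmegaTsirelson p θseq TZ x (max Cu Ce) :=
    { one_le_p := hp
      regular := hreg
      isNorm := hTZ
      ne_zero := hbasis.1
      one_le_C := hCu.trans (le_max_left _ _)
      unc := fun a F hF => (hu a F hF).trans (hle _ (norm_nonneg _)).1
      norm_le := fun v hv => by
        have h1 := (he v.support hv v).2
        rw [hsum] at h1
        exact h1.trans (hle _ (hTZ.nonneg v)).2
      le_norm := fun v hv => by
        have h1 := (he v.support hv v).1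
        rw [hsum, one_div, inv_mul_le_iff₀ (by positivity)] at h1
        exact h1.trans (hle _ (norm_nonneg _)).2 }
  exact h.exists_strictlySingular hθ hratio
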